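/- arXiv:1511.05735 — 4 statements merged into one kernel-verified Lean document; each statement's English description precedes it below -/
import Mathlib

section
/- Let t_j < t_{j+1}, x_j, x_{j+1} ∈ ℝ, ℓ = t_{j+1} − t_j, d = |x_{j+1} − x_j|. Let B be a Brownian bridge from (t_j, x_j) to (t_{j+1}, x_{j+1}) with a.s. unique minimizer, and let θ(B) denote the location of its minimum. Then the law of θ(B) has density f(s) = (d/ℓ^{3/2}) √(2/(π h(s))) exp(−(d²/(2ℓ)) h(s)) + ((ℓ − d²)/ℓ²) erfc( ((d²/(2ℓ)) h(s))^{1/2} ) for t_j ≤ s ≤ t_{j+1} (and 0 otherwise), where h(s) = (t_{j+1} − s)/(s − t_j) if x_{j+1} ≤ x_j and h(s) = (s − t_j)/(t_{j+1} − s) if x_j ≤ x_{j+1}, and erfc(x) = 1 − (2/√π)∫_0^x e^{−t²} dt is the complementary error function. -/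
open MeasureTheory ProbabilityTheory Real

/-- Probability that a bridge of length `L` from `a` to `c` stays positive. -/
noncomputable def gk (L a c : ℝ) : ℝ := 1 - Real.exp (-(2 * max a 0 * max c 0 / L))

lemma gk_continuous (L : ℝ) : Continuous (fun p : ℝ × ℝ => gk L p.1 p.2) := by
  unfold gk; fun_prop

lemma gk_nonneg {L : ℝ} (hL : 0 < L) (a c : ℝ) : 0 ≤ gk L a c := by
  unfold gk
  have : Real.exp (-(2 * max a 0 * max c 0 / L)) ≤ 1 := by
    rw [Real.exp_le_one_iff, neg_nonpos]; positivity
  linarith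

lemma gk_le_one (L a c : ℝ) : gk L a c ≤ 1 := by
  unfold gk
  have := Real.exp_pos (-(2 * max a 0 * max c 0 / L))
  linarith

lemma gk_left {L a c : ℝ} (h : a ≤ 0) : gk L a c = 0 := by
  simp [gk, max_eq_right h]

lemma gk_right {L a c : ℝ} (h : c ≤ 0) : gk L a c = 0 := by
  simp [gk, max_eq_right h]

lemma gk_pos {L a c : ℝ} (ha : 0 ≤ a) (h : 0 ≤ c) : gk L a c = 1 - Real.exp (-(2 * a * c / L)) := by
  simp [gk, max_eq_left h, max_eq_left ha]

lemma gk_lower {L a c ε : ℝ} (hL : 0 < L) (hε : 0 ≤ ε) (ha : ε ≤ a) (h : ε ≤ c) :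
    1 - Real.exp (-(2 * ε * ε / L)) ≤ gk L a c := by
  rw [gk_pos (hε.trans ha) (hε.trans h)]
  gcongr
  linarith

/-- product of two heat kernels -/
lemma pdf_identity {α β a c x : ℝ} (hα : 0 < α) (hβ : 0 < β) (V : NNReal)
    (hV : (V : ℝ) = α * β / (α + β)) :
    gaussianPDFReal ((β * a + α * c) / (α + β)) V x *
      ((1 - Real.exp (-(2 * a * x / α))) * (1 - Real.exp (-(2 * x * c / β)))) =
    (gaussianPDFReal ((β * a + α * c) / (α + β)) V x
      - Real.exp (-(2 * a * c / (α + β))) * gaussianPDFReal ((- β * a + α * c) / (α + β)) V x) +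
    (gaussianPDFReal ((β * a + α * c) / (α + β)) V (-x)
      - Real.exp (-(2 * a * c / (α + β))) * gaussianPDFReal ((- β * a + α * c) / (α + β)) V (-x)) := by
  have hs : 0 < α + β := by positivity
  simp only [gaussianPDFReal, hV]
  set K := (√(2 * π * (α * β / (α + β))))⁻¹
  have e1 : rexp (-(x - (β * a + α * c) / (α + β)) ^ 2 / (2 * (α * β / (α + β)))) *
     rexp (-(2 * a * x / α)) = rexp (-(2 * a * c / (α + β))) *
      rexp (-(x - (- β * a + α * c) / (α + β)) ^ 2 / (2 * (α * β / (α + β)))) := by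
    rw [← Real.exp_add, ← Real.exp_add]; congr 1; field_simp; ring
  have e2 : rexp (-(x - (β * a + α * c) / (α + β)) ^ 2 / (2 * (α * β / (α + β)))) *
     rexp (-(2 * x * c / β)) = rexp (-(2 * a * c / (α + β))) *
      rexp (-(-x - (- β * a + α * c) / (α + β)) ^ 2 / (2 * (α * β / (α + β)))) := by
    rw [← Real.exp_add, ← Real.exp_add]; congr 1; field_simp; ring
  have e3 : rexp (-(x - (β * a + α * c) / (α + β)) ^ 2 / (2 * (α * β / (α + β)))) *
     (rexp (-(2 * a * x / α)) * rexp (-(2 * x * c / β))) =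
      rexp (-(-x - (β * a + α * c) / (α + β)) ^ 2 / (2 * (α * β / (α + β)))) := by
    rw [← Real.exp_add, ← Real.exp_add]; congr 1; field_simp; ring
  linear_combination (-K) * e1 - K * e2 + K * e3

lemma integral_symm {n : ℝ → ℝ} (hn : Integrable n) :
    ∫ x, (if 0 < x then n x + n (-x) else 0) = ∫ x, n x := by
  have h1 : (fun x => if 0 < x then n x + n (-x) else 0) =
      Set.indicator (Set.Ioi 0) (fun x => n x + n (-x)) := by
    ext x; simp [Set.indicator]
  rw [h1, integral_indicator measurableSet_Ioi, integral_add hn.integrableOn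
    (hn.comp_neg).integrableOn, integral_comp_neg_Ioi, neg_zero, add_comm]
  exact intervalIntegral.integral_Iic_add_Ioi hn.integrableOn hn.integrableOn

lemma chapman_kolmogorov {α β : ℝ} (hα : 0 < α) (hβ : 0 < β) (a c : ℝ) :
    ∫ x, gk α a ((β * a + α * c) / (α + β) + x) * gk β ((β * a + α * c) / (α + β) + x) c
      ∂(gaussianReal 0 (α * β / (α + β)).toNNReal) = gk (α + β) a c := by
  have hs : 0 < α + β := by positivity
  set V : NNReal := (α * β / (α + β)).toNNReal with hVd
  have hV : (V : ℝ) = α * β / (α + β) := Real.coe_toNNReal _ (by positivity)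
  have hV0 : V ≠ 0 := by
    intro h; rw [h] at hV; have : 0 < α * β / (α + β) := by positivity
    simp only [NNReal.coe_zero] at hV; linarith
  set μ := (β * a + α * c) / (α + β) with hμ
  have hmap : gaussianReal μ V = (gaussianReal 0 V).map (fun x => μ + x) := by
    rw [gaussianReal_map_const_add]; simp
  rcases le_or_gt a 0 with ha | ha
  · simp [gk_left ha]
  rcases le_or_gt c 0 with hc | hc
  · simp [gk_right hc]
  have : ∫ x, gk α a (μ + x) * gk β (μ + x) c ∂(gaussianReal 0 V) =
      ∫ x, gk α a x * gk β x c ∂(gaussianReal μ V) := by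
    rw [hmap, integral_map (by fun_prop)]
    apply Continuous.aestronglyMeasurable
    unfold gk; fun_prop
  rw [this, integral_gaussianReal_eq_integral_smul hV0]
  set n : ℝ → ℝ := fun x => gaussianPDFReal ((β * a + α * c) / (α + β)) V x
      - Real.exp (-(2 * a * c / (α + β))) * gaussianPDFReal ((- β * a + α * c) / (α + β)) V x with hn
  have hni : Integrable n :=
    (integrable_gaussianPDFReal _ _).sub ((integrable_gaussianPDFReal _ _).const_mul _)
  have hfun : (fun x => gaussianPDFReal μ V x • (gk α a x * gk β x c)) =
      fun x => if 0 < x then n x + n (-x) else 0 := by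
    ext x
    split_ifs with hx
    · rw [gk_pos ha.le hx.le, gk_pos hx.le hc.le, smul_eq_mul]
      exact pdf_identity hα hβ V hV
    · rw [gk_right (not_lt.1 hx)]; simp
  rw [hfun, integral_symm hni, hn, integral_sub (integrable_gaussianPDFReal _ _)
    ((integrable_gaussianPDFReal _ _).const_mul _), integral_const_mul,
    integral_gaussianPDFReal_eq_one _ hV0, integral_gaussianPDFReal_eq_one _ hV0,
    gk_pos ha.le hc.le, mul_one]
open MeasureTheory ProbabilityTheory Real

/-- Brownian bridge data, as in the main statement. -/
structure Bridge {Ω : Type*} [MeasurableSpace Ω] (P : Measure Ω)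
    (t0 t1 x0 x1 : ℝ) (B : ℝ → Ω → ℝ) : Prop where
  lt : t0 < t1
  meas : ∀ s, Measurable (B s)
  cont : ∀ᵐ ω ∂P, ContinuousOn (fun s => B s ω) (Set.Icc t0 t1)
  gauss : ∀ (k : ℕ) (ts : Fin k → ℝ) (c : Fin k → ℝ),
      (∀ i, ts i ∈ Set.Icc t0 t1) →
      P.map (fun ω => ∑ i, c i * B (ts i) ω) =
        gaussianReal
          (∑ i, c i * (x0 + (ts i - t0) / (t1 - t0) * (x1 - x0)))
          (Real.toNNReal (∑ i, ∑ i', c i * c i' *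
            ((min (ts i) (ts i') - t0) * (t1 - max (ts i) (ts i')) / (t1 - t0))))

lemma var_of_map {Ω : Type*} [MeasurableSpace Ω] {P : Measure Ω} {X : Ω → ℝ} (hX : Measurable X)
    {m : ℝ} {v : NNReal} (h : P.map X = gaussianReal m v) : Var[X; P] = v := by
  have h1 : Var[id; P.map X] = v := by rw [h]; exact variance_id_gaussianReal
  rwa [variance_map aemeasurable_id hX.aemeasurable, Function.id_comp] at h1

set_option linter.unusedSectionVars false

namespace Bridge

variable {Ω : Type*} [MeasurableSpace Ω] {P : Measure Ω} [IsProbabilityMeasure P]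
  {t0 t1 x0 x1 : ℝ} {B : ℝ → Ω → ℝ}

lemma gproc (h : Bridge P t0 t1 x0 x1 B) :
    IsGaussianProcess (fun t : Set.Icc t0 t1 => B t) P := by
  classical
  constructor
  intro I
  constructor
  have hm : Measurable (fun ω => I.restrict (fun t : Set.Icc t0 t1 => B t ω)) := by
    apply measurable_pi_lambda
    intro i
    exact h.meas _
  apply isGaussian_of_map_eq_gaussianReal
  intro L
  rw [Measure.map_map (by fun_prop) hm]
  let e := I.equivFin
  have hL : (L ∘ fun ω => I.restrict (fun t : Set.Icc t0 t1 => B t ω)) =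
      fun ω => ∑ i : Fin I.card, L (fun j => if e.symm i = j then 1 else 0) * B ((e.symm i).1 : Set.Icc t0 t1) ω := by
    ext ω
    simp only [Function.comp]
    rw [← Equiv.sum_comp e]
    simp only [Equiv.symm_apply_apply]
    have := LinearMap.pi_apply_eq_sum_univ (L : (I → ℝ) →ₗ[ℝ] ℝ)
      (I.restrict (fun t : Set.Icc t0 t1 => B t ω))
    simp only [ContinuousLinearMap.coe_coe] at this
    rw [this]
    apply Finset.sum_congr rfl
    intro i _
    rw [smul_eq_mul, mul_comm]
    rfl
  rw [hL]
  exact ⟨_, _, h.gauss _ _ _ (fun i => (e.symm i).1.2)⟩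

lemma memLp (h : Bridge P t0 t1 x0 x1 B) {s : ℝ} (hs : s ∈ Set.Icc t0 t1) : MemLp (B s) 2 P :=
  (h.gproc.hasGaussianLaw_eval ⟨s, hs⟩).memLp_two

lemma law (h : Bridge P t0 t1 x0 x1 B) {s : ℝ} (hs : s ∈ Set.Icc t0 t1) :
    P.map (B s) = gaussianReal (x0 + (s - t0) / (t1 - t0) * (x1 - x0))
      ((s - t0) * (t1 - s) / (t1 - t0)).toNNReal := by
  have := h.gauss 1 (fun _ => s) (fun _ => 1) (fun _ => hs)
  simpa using this

lemma var (h : Bridge P t0 t1 x0 x1 B) {s : ℝ} (hs : s ∈ Set.Icc t0 t1) :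
    Var[B s; P] = (s - t0) * (t1 - s) / (t1 - t0) := by
  have h1 := var_of_map (h.meas s) (h.law hs)
  have h2 := h.lt
  rw [h1, Real.coe_toNNReal]
  exact div_nonneg (mul_nonneg (by linarith [hs.1]) (by linarith [hs.2])) (by linarith)

lemma cov (h : Bridge P t0 t1 x0 x1 B) {s t : ℝ} (hs : s ∈ Set.Icc t0 t1)
    (ht : t ∈ Set.Icc t0 t1) (hst : s ≤ t) :
    cov[B s, B t; P] = (s - t0) * (t1 - t) / (t1 - t0) := by
  have h2 := h.lt
  have h0 := h.gauss 2 ![s, t] ![1, 1] (by intro i; fin_cases i <;> simpa)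
  simp only [Fin.sum_univ_two, Matrix.cons_val_zero, Matrix.cons_val_one, one_mul, min_self,
    max_self, min_eq_left hst, min_eq_right hst, max_eq_left hst, max_eq_right hst] at h0
  have h1 := var_of_map ((h.meas s).add (h.meas t)) h0
  rw [variance_add (h.memLp hs) (h.memLp ht), h.var hs, h.var ht, Real.coe_toNNReal] at h1
  · linarith
  · have a1 : 0 ≤ s - t0 := by linarith [hs.1]
    have a2 : 0 ≤ t1 - t := by linarith [ht.2]
    have a3 : 0 ≤ t - t0 := by linarith [hs.1]
    have a4 : 0 ≤ t1 - s := by linarith [ht.2]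
    have a5 : 0 ≤ t1 - t0 := by linarith
    positivity

/-- The bridge innovation at `v` given `u` and `w`. -/
noncomputable def innov (B : ℝ → Ω → ℝ) (u v w : ℝ) (ω : Ω) : ℝ :=
  B v ω - ((w - v) / (w - u) * B u ω + (v - u) / (w - u) * B w ω)

lemma innov_meas (h : Bridge P t0 t1 x0 x1 B) (u v w : ℝ) : Measurable (innov B u v w) := by
  have := h.meas
  unfold innov; fun_prop

lemma innov_law (h : Bridge P t0 t1 x0 x1 B) {u v w : ℝ} (h0 : t0 ≤ u) (huv : u < v)
    (hvw : v < w) (h1 : w ≤ t1) :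
    P.map (innov B u v w) = gaussianReal 0 ((v - u) * (w - v) / ((v - u) + (w - v))).toNNReal := by
  have h2 := h.lt
  have e := h.gauss 3 ![v, u, w] ![1, -((w - v) / (w - u)), -((v - u) / (w - u))]
    (by intro i; fin_cases i <;> simp <;> constructor <;> linarith)
  have hf : (fun ω => ∑ i, ![1, -((w - v) / (w - u)), -((v - u) / (w - u))] i * B (![v, u, w] i) ω)
      = innov B u v w := by
    ext ω; simp [Fin.sum_univ_three, innov]; ring
  rw [hf] at e
  rw [e]
  have n1 : t1 - t0 ≠ 0 := by linarith
  have n2 : w - u ≠ 0 := by linarith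
  have huw : u < w := huv.trans hvw
  have n3 : (v - u) + (w - v) = w - u := by ring
  rw [n3]
  congr 1
  · simp [Fin.sum_univ_three]; field_simp; ring
  · congr 1
    simp [Fin.sum_univ_three, min_eq_left huv.le, min_eq_right huv.le, max_eq_left huv.le,
      max_eq_right huv.le, min_eq_left hvw.le, min_eq_right hvw.le, max_eq_left hvw.le,
      max_eq_right hvw.le, min_eq_left huw.le, min_eq_right huw.le, max_eq_left huw.le,
      max_eq_right huw.le]
    field_simp; ring

/-- times outside the open interval `(u,w)` -/
def outside (t0 t1 u w : ℝ) : Set ℝ := Set.Icc t0 u ∪ Set.Icc w t1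

lemma cov_innov (h : Bridge P t0 t1 x0 x1 B) {u v w t : ℝ} (h0 : t0 ≤ u) (huv : u < v)
    (hvw : v < w) (h1 : w ≤ t1) (ht : t ∈ outside t0 t1 u w) :
    cov[innov B u v w, B t; P] = 0 := by
  have h2 := h.lt
  have hu : u ∈ Set.Icc t0 t1 := ⟨h0, by linarith⟩
  have hv : v ∈ Set.Icc t0 t1 := ⟨by linarith, by linarith⟩
  have hw : w ∈ Set.Icc t0 t1 := ⟨by linarith, by linarith⟩
  have ht' : t ∈ Set.Icc t0 t1 := by
    rcases ht with ht | ht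
    · exact ⟨ht.1, by linarith [ht.2]⟩
    · exact ⟨by linarith [ht.1], ht.2⟩
  have n1 : t1 - t0 ≠ 0 := by linarith
  have n2 : w - u ≠ 0 := by linarith
  have e : innov B u v w = B v - (((w - v) / (w - u)) • B u + ((v - u) / (w - u)) • B w) := by
    ext ω; simp [innov]
  have mu := (h.memLp hu).const_smul ((w - v) / (w - u))
  have mw := (h.memLp hw).const_smul ((v - u) / (w - u))
  rw [e, covariance_sub_left (h.memLp hv) (mu.add mw) (h.memLp ht'),
    covariance_add_left mu mw (h.memLp ht'),
    covariance_smul_left, covariance_smul_left]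
  rcases ht with ht | ht
  · have a1 : t ≤ u := ht.2
    rw [covariance_comm, h.cov ht' hv (by linarith), covariance_comm (B u), h.cov ht' hu a1,
      covariance_comm (B w), h.cov ht' hw (by linarith)]
    field_simp; ring
  · have a1 : w ≤ t := ht.1
    rw [h.cov hv ht' (by linarith), h.cov hu ht' (by linarith), h.cov hw ht' (by linarith)]
    field_simp; ring

lemma innov_indep (h : Bridge P t0 t1 x0 x1 B) {u v w : ℝ} (h0 : t0 ≤ u) (huv : u < v)
    (hvw : v < w) (h1 : w ≤ t1) :
    IndepFun (fun ω (t : outside t0 t1 u w) => B t ω) (innov B u v w) P := by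
  classical
  have h2 := h.lt
  have hu : u ∈ Set.Icc t0 t1 := ⟨h0, by linarith⟩
  have hv : v ∈ Set.Icc t0 t1 := ⟨by linarith, by linarith⟩
  have hw : w ∈ Set.Icc t0 t1 := ⟨by linarith, by linarith⟩
  have hout : ∀ t ∈ outside t0 t1 u w, t ∈ Set.Icc t0 t1 := by
    rintro t (ht | ht)
    · exact ⟨ht.1, by linarith [ht.2]⟩
    · exact ⟨by linarith [ht.1], ht.2⟩
  have hG : IsGaussianProcess (Sum.elim (fun t : outside t0 t1 u w => B t)
      (fun _ : Unit => innov B u v w)) P := by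
    refine IsGaussianProcess.of_isGaussianProcess h.gproc ?_
    rintro (t | _)
    · refine ⟨{⟨t, hout _ t.2⟩}, ContinuousLinearMap.proj ⟨⟨t, hout _ t.2⟩, by simp⟩, ?_⟩
      intro ω; simp
    · refine ⟨{⟨u, hu⟩, ⟨v, hv⟩, ⟨w, hw⟩}, 
        ContinuousLinearMap.proj ⟨⟨v, hv⟩, by simp⟩ -
        (((w - v) / (w - u)) • ContinuousLinearMap.proj ⟨⟨u, hu⟩, by simp⟩ +
         ((v - u) / (w - u)) • ContinuousLinearMap.proj ⟨⟨w, hw⟩, by simp⟩), ?_⟩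
      intro ω; simp [innov]
  have := hG.indepFun_of_covariance_eq_zero (fun t => (h.meas _).aemeasurable)
    (fun _ => (h.innov_meas u v w).aemeasurable) (fun t _ => by
      rw [covariance_comm]; exact h.cov_innov h0 huv hvw h1 t.2)
  exact this.comp (φ := id) (ψ := fun f : Unit → ℝ => f ()) measurable_id (by fun_prop)

end Bridge
open MeasureTheory ProbabilityTheory Real
set_option linter.unusedSectionVars false

namespace Bridge

variable {Ω : Type*} [MeasurableSpace Ω] {P : Measure Ω} [IsProbabilityMeasure P]
  {t0 t1 x0 x1 : ℝ} {B : ℝ → Ω → ℝ}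

/-- sigma-algebra generated by the bridge outside `(u,w)` -/
def sig (B : ℝ → Ω → ℝ) (t0 t1 u w : ℝ) : MeasurableSpace Ω :=
  MeasurableSpace.comap (fun ω (t : outside t0 t1 u w) => B t ω) inferInstance

lemma sig_le (h : Bridge P t0 t1 x0 x1 B) (u w : ℝ) :
    sig B t0 t1 u w ≤ (inferInstance : MeasurableSpace Ω) := by
  rw [sig, ← measurable_iff_comap_le]
  exact measurable_pi_lambda _ (fun t => h.meas _)

lemma meas_sig {u w t : ℝ} (ht : t ∈ outside t0 t1 u w) :
    Measurable[sig B t0 t1 u w] (B t) := by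
  have h1 : Measurable[sig B t0 t1 u w] (fun ω (t : outside t0 t1 u w) => B t ω) :=
    comap_measurable _
  exact (measurable_pi_apply (⟨t, ht⟩ : outside t0 t1 u w)).comp h1

lemma sig_mono {u w u' w' : ℝ} (hu : u ≤ u') (hw : w' ≤ w) :
    sig B t0 t1 u w ≤ sig B t0 t1 u' w' := by
  conv_lhs => rw [sig]
  rw [← measurable_iff_comap_le]
  refine @measurable_pi_lambda _ _ _ (sig B t0 t1 u' w') _ _ (fun t => meas_sig ?_)
  rcases t.2 with ht | ht
  · exact Or.inl ⟨ht.1, ht.2.trans hu⟩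
  · exact Or.inr ⟨hw.trans ht.1, ht.2⟩

lemma gk_meas (L : ℝ) {m : MeasurableSpace Ω} {a c : Ω → ℝ} (ha : Measurable a)
    (hc : Measurable c) : Measurable (fun ω => gk L (a ω) (c ω)) :=
  (gk_continuous L).measurable.comp (ha.prodMk hc)

lemma insertion (h : Bridge P t0 t1 x0 x1 B) {u v w : ℝ} (h0 : t0 ≤ u) (huv : u < v)
    (hvw : v < w) (h1 : w ≤ t1) {F Y : Ω → ℝ} (hF : Measurable[sig B t0 t1 u w] F)
    (hY : Measurable[sig B t0 t1 u w] Y) (hF0 : ∀ ω, 0 ≤ F ω) (hF1 : ∀ ω, F ω ≤ 1) :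
    ∫ ω, F ω * (gk (v - u) (B u ω - Y ω) (B v ω - Y ω) * gk (w - v) (B v ω - Y ω) (B w ω - Y ω)) ∂P
      = ∫ ω, F ω * gk (w - u) (B u ω - Y ω) (B w ω - Y ω) ∂P := by
  have huw := huv.trans hvw
  set W : Ω → ℝ × ℝ × ℝ := fun ω => (F ω, B u ω - Y ω, B w ω - Y ω) with hW
  set Z := innov B u v w with hZ
  have hBu : Measurable[sig B t0 t1 u w] (B u) := meas_sig (Or.inl ⟨h0, le_rfl⟩)
  have hBw : Measurable[sig B t0 t1 u w] (B w) := meas_sig (Or.inr ⟨le_rfl, h1⟩)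
  have hWs : Measurable[sig B t0 t1 u w] W :=
    hF.prodMk ((hBu.sub hY).prodMk (hBw.sub hY))
  have hWm : Measurable W := hWs.mono (h.sig_le u w) le_rfl
  have hZm : Measurable Z := h.innov_meas u v w
  have hind : IndepFun W Z P := by
    have := h.innov_indep h0 huv hvw h1
    rw [IndepFun_iff_Indep] at this ⊢
    exact indep_of_indep_of_le_left this (measurable_iff_comap_le.1 hWs)
  set k : (ℝ × ℝ × ℝ) × ℝ → ℝ := fun p => p.1.1 *
    (gk (v - u) p.1.2.1 (((w - v) * p.1.2.1 + (v - u) * p.1.2.2) / ((v - u) + (w - v)) + p.2) *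
     gk (w - v) (((w - v) * p.1.2.1 + (v - u) * p.1.2.2) / ((v - u) + (w - v)) + p.2) p.1.2.2) with hk
  have hkc : Continuous k := by
    rw [hk]; unfold gk; fun_prop
  have hWZ : P.map (fun ω => (W ω, Z ω)) = (P.map W).prod (P.map Z) :=
    (indepFun_iff_map_prod_eq_prod_map_map hWm.aemeasurable hZm.aemeasurable).1 hind
  have hL : ∀ ω, F ω * (gk (v - u) (B u ω - Y ω) (B v ω - Y ω) *
      gk (w - v) (B v ω - Y ω) (B w ω - Y ω)) = k (W ω, Z ω) := by
    intro ω
    have : ((w - v) * (B u ω - Y ω) + (v - u) * (B w ω - Y ω)) / ((v - u) + (w - v)) + Z ω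
        = B v ω - Y ω := by
      have : v - u + (w - v) ≠ 0 := by linarith
      have : w - u ≠ 0 := by linarith
      simp only [hZ, innov]; field_simp; ring
    simp only [hk, hW, this]
  have hint : Integrable k ((P.map W).prod (P.map Z)) := by
    rw [← hWZ, integrable_map_measure hkc.aestronglyMeasurable (hWm.prodMk hZm).aemeasurable]
    refine Integrable.of_bound (C := 1) (hkc.measurable.comp (hWm.prodMk hZm)).aestronglyMeasurable ?_
    refine Filter.Eventually.of_forall (fun ω => ?_)
    simp only [Function.comp]
    rw [← hL ω, Real.norm_eq_abs, abs_of_nonneg]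
    · exact mul_le_one₀ (hF1 ω) (mul_nonneg (gk_nonneg (by linarith) _ _) (gk_nonneg (by linarith) _ _))
        (mul_le_one₀ (gk_le_one _ _ _) (gk_nonneg (by linarith) _ _) (gk_le_one _ _ _))
    · exact mul_nonneg (hF0 ω)
        (mul_nonneg (gk_nonneg (by linarith) _ _) (gk_nonneg (by linarith) _ _))
  calc _ = ∫ ω, k (W ω, Z ω) ∂P := by simp only [hL]
    _ = ∫ p, k p ∂(P.map (fun ω => (W ω, Z ω))) := by
        rw [integral_map (hWm.prodMk hZm).aemeasurable hkc.aestronglyMeasurable]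
    _ = ∫ p, ∫ z, k (p, z) ∂(P.map Z) ∂(P.map W) := by
        rw [hWZ, integral_prod _ hint]
    _ = ∫ p, p.1 * gk (w - u) p.2.1 p.2.2 ∂(P.map W) := by
        congr 1; ext p
        rw [h.innov_law h0 huv hvw h1]
        simp only [hk]
        rw [integral_const_mul, chapman_kolmogorov (by linarith) (by linarith)]
        congr 2; ring
    _ = _ := by
        rw [integral_map hWm.aemeasurable]
        apply Continuous.aestronglyMeasurable
        unfold gk; fun_prop

/-- grid point -/
noncomputable def gp (u w : ℝ) (N i : ℕ) : ℝ := u + (w - u) * (i / N)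

lemma gp_diff (u w : ℝ) {N : ℕ} (hN : 0 < N) (i : ℕ) :
    gp u w N (i + 1) - gp u w N i = (w - u) / N := by
  have : (N : ℝ) ≠ 0 := by positivity
  simp only [gp]; push_cast; field_simp; ring

lemma grid_step (h : Bridge P t0 t1 x0 x1 B) {u w : ℝ} (h0 : t0 ≤ u) (huw : u < w)
    (h1 : w ≤ t1) {F Y : Ω → ℝ} (hF : Measurable[sig B t0 t1 u w] F)
    (hY : Measurable[sig B t0 t1 u w] Y) (hF0 : ∀ ω, 0 ≤ F ω) (hF1 : ∀ ω, F ω ≤ 1)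
    {N : ℕ} (hN : 0 < N) (k : ℕ) (hk : k + 1 ≤ N) :
    ∫ ω, F ω * (∏ i ∈ Finset.range k,
        gk ((w - u) / N) (B (gp u w N i) ω - Y ω) (B (gp u w N (i + 1)) ω - Y ω)) *
        gk (w - gp u w N k) (B (gp u w N k) ω - Y ω) (B w ω - Y ω) ∂P
      = ∫ ω, F ω * gk (w - u) (B u ω - Y ω) (B w ω - Y ω) ∂P := by
  have hNr : (0 : ℝ) < N := by positivity
  have hδ : 0 < (w - u) / N := div_pos (by linarith) hNr
  have hge : ∀ i, u ≤ gp u w N i := by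
    intro i; unfold gp
    have : 0 ≤ (w - u) * ((i : ℝ) / N) := mul_nonneg (by linarith) (by positivity)
    linarith
  have hmono : ∀ i j, i ≤ j → gp u w N i ≤ gp u w N j := by
    intro i j hij; unfold gp
    have : ((i : ℝ) / N) ≤ j / N := by gcongr
    nlinarith
  have hlt : ∀ i, i < N → gp u w N i < w := by
    intro i hi; unfold gp
    have : ((i : ℝ) / N) < 1 := by rw [div_lt_one hNr]; exact_mod_cast hi
    nlinarith
  induction k with
  | zero => simp [gp]
  | succ k ih =>
    rw [← ih (by omega)]
    set u' := gp u w N k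
    set v' := gp u w N (k + 1)
    have hd : v' - u' = (w - u) / N := gp_diff u w hN k
    set F' : Ω → ℝ := fun ω => F ω * ∏ i ∈ Finset.range k,
        gk ((w - u) / N) (B (gp u w N i) ω - Y ω) (B (gp u w N (i + 1)) ω - Y ω) with hF'
    have hs : sig B t0 t1 u w ≤ sig B t0 t1 u' w := sig_mono (hge k) le_rfl
    have hY' : Measurable[sig B t0 t1 u' w] Y := hY.mono hs le_rfl
    have hB : ∀ i ≤ k, Measurable[sig B t0 t1 u' w] (B (gp u w N i)) := fun i hi =>
      meas_sig (Or.inl ⟨h0.trans (hge i), hmono _ _ hi⟩)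
    have hprod : Measurable[sig B t0 t1 u' w] (fun ω => ∏ i ∈ Finset.range k,
        gk ((w - u) / N) (B (gp u w N i) ω - Y ω) (B (gp u w N (i + 1)) ω - Y ω)) := by
      refine Finset.measurable_fun_prod _ (fun i hi => ?_)
      have hi' := Finset.mem_range.1 hi
      exact gk_meas _ ((hB i hi'.le).sub hY') ((hB (i + 1) hi').sub hY')
    have hF'm : Measurable[sig B t0 t1 u' w] F' := (hF.mono hs le_rfl).mul hprod
    have hp0 : ∀ ω, 0 ≤ ∏ i ∈ Finset.range k,
        gk ((w - u) / N) (B (gp u w N i) ω - Y ω) (B (gp u w N (i + 1)) ω - Y ω) :=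
      fun ω => Finset.prod_nonneg (fun i _ => gk_nonneg hδ _ _)
    have hp1 : ∀ ω, ∏ i ∈ Finset.range k,
        gk ((w - u) / N) (B (gp u w N i) ω - Y ω) (B (gp u w N (i + 1)) ω - Y ω) ≤ 1 :=
      fun ω => Finset.prod_le_one (fun i _ => gk_nonneg hδ _ _) (fun i _ => gk_le_one _ _ _)
    have := h.insertion (u := u') (v := v') (w := w) (h0.trans (hge k)) (by linarith)
      (hlt _ (by omega)) h1 hF'm hY' (fun ω => mul_nonneg (hF0 ω) (hp0 ω))
      (fun ω => mul_le_one₀ (hF1 ω) (hp0 ω) (hp1 ω))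
    rw [← this, hd]
    congr 1; ext ω
    rw [Finset.prod_range_succ]
    simp only [hF']
    ring

/-- product functional -/
noncomputable def Mf (B : ℝ → Ω → ℝ) (Y : Ω → ℝ) (u w : ℝ) (N : ℕ) (ω : Ω) : ℝ :=
  ∏ i ∈ Finset.range N,
        gk ((w - u) / N) (B (gp u w N i) ω - Y ω) (B (gp u w N (i + 1)) ω - Y ω)

lemma grid (h : Bridge P t0 t1 x0 x1 B) {u w : ℝ} (h0 : t0 ≤ u) (huw : u < w)
    (h1 : w ≤ t1) {F Y : Ω → ℝ} (hF : Measurable[sig B t0 t1 u w] F)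
    (hY : Measurable[sig B t0 t1 u w] Y) (hF0 : ∀ ω, 0 ≤ F ω) (hF1 : ∀ ω, F ω ≤ 1)
    {N : ℕ} (hN : 0 < N) :
    ∫ ω, F ω * Mf B Y u w N ω ∂P
      = ∫ ω, F ω * gk (w - u) (B u ω - Y ω) (B w ω - Y ω) ∂P := by
  obtain ⟨k, rfl⟩ : ∃ k, N = k + 1 := ⟨N - 1, by omega⟩
  rw [← h.grid_step h0 huw h1 hF hY hF0 hF1 hN k le_rfl]
  congr 1; ext ω
  have hw : gp u w (k + 1) (k + 1) = w := by
    have : ((k + 1 : ℕ) : ℝ) ≠ 0 := by positivity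
    unfold gp; field_simp; ring
  have := gp_diff u w hN k
  rw [hw] at this
  unfold Mf
  rw [this, Finset.prod_range_succ, hw]
  ring

end Bridge
open MeasureTheory ProbabilityTheory Real Filter Topology
set_option linter.unusedSectionVars false

namespace Bridge

variable {Ω : Type*} [MeasurableSpace Ω] {P : Measure Ω} [IsProbabilityMeasure P]
  {t0 t1 x0 x1 : ℝ} {B : ℝ → Ω → ℝ}

/-- minimum over `[u,w]` (as infimum over dyadic points) -/
noncomputable def mn (B : ℝ → Ω → ℝ) (u w : ℝ) (ω : Ω) : ℝ :=
  ⨅ p : ℕ × ℕ, B (gp u w (2 ^ p.1) (min p.2 (2 ^ p.1))) ω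

lemma gp_mem {u w : ℝ} (huw : u ≤ w) (N i : ℕ) (hN : 0 < N) (hi : i ≤ N) :
    gp u w N i ∈ Set.Icc u w := by
  have hNr : (0 : ℝ) < N := by positivity
  have h1 : ((i : ℝ) / N) ≤ 1 := by rw [div_le_one hNr]; exact_mod_cast hi
  have h2 : 0 ≤ (i : ℝ) / N := by positivity
  unfold gp
  constructor <;> nlinarith

lemma gp_mem' {u w : ℝ} (huw : u ≤ w) (p : ℕ × ℕ) :
    gp u w (2 ^ p.1) (min p.2 (2 ^ p.1)) ∈ Set.Icc u w :=
  gp_mem huw _ _ (by positivity) (min_le_right _ _)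

lemma mn_meas {m : MeasurableSpace Ω} {u w : ℝ} (huw : u ≤ w)
    (hB : ∀ t ∈ Set.Icc u w, Measurable[m] (B t)) : Measurable[m] (mn B u w) := by
  unfold mn
  exact Measurable.iInf (fun p => hB _ (gp_mem' huw p))

lemma bdd {u w : ℝ} (huw : u ≤ w) {ω : Ω}
    (hc : ContinuousOn (fun s => B s ω) (Set.Icc u w)) :
    BddBelow (Set.range fun p : ℕ × ℕ => B (gp u w (2 ^ p.1) (min p.2 (2 ^ p.1))) ω) := by
  obtain ⟨c, hc⟩ := (isCompact_Icc.image_of_continuousOn hc).bddBelow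
  refine ⟨c, ?_⟩
  rintro _ ⟨p, rfl⟩
  exact hc ⟨_, gp_mem' huw p, rfl⟩

lemma mn_le {u w : ℝ} (huw : u < w) {ω : Ω}
    (hc : ContinuousOn (fun s => B s ω) (Set.Icc u w)) {t : ℝ} (ht : t ∈ Set.Icc u w) :
    mn B u w ω ≤ B t ω := by
  set r := (t - u) / (w - u) with hr
  have hw : 0 < w - u := by linarith
  have hr0 : 0 ≤ r := div_nonneg (by linarith [ht.1]) hw.le
  have hr1 : r ≤ 1 := by rw [hr, div_le_one hw]; linarith [ht.2]
  have htr : t = u + (w - u) * r := by rw [hr]; field_simp; ring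
  have hfl : ∀ n : ℕ, min (⌊r * 2 ^ n⌋₊) (2 ^ n) = ⌊r * 2 ^ n⌋₊ := by
    intro n
    apply min_eq_left
    rw [← Nat.floor_natCast (R := ℝ) (2 ^ n)]
    apply Nat.floor_le_floor
    push_cast
    exact mul_le_of_le_one_left (by positivity) hr1
  have hlim : Tendsto (fun n : ℕ => gp u w (2 ^ n) (min (⌊r * 2 ^ n⌋₊) (2 ^ n))) atTop (𝓝 t) := by
    have h1 : Tendsto (fun n : ℕ => ((⌊r * 2 ^ n⌋₊ : ℕ) : ℝ) / ((2 : ℝ) ^ n)) atTop (𝓝 r) :=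
      (tendsto_nat_floor_mul_div_atTop hr0).comp
        (tendsto_pow_atTop_atTop_of_one_lt (by norm_num : (1 : ℝ) < 2))
    have h2 := (h1.const_mul (w - u)).const_add u
    rw [← htr] at h2
    refine h2.congr (fun n => ?_)
    rw [hfl]; simp [gp]
  have hlim' : Tendsto (fun n : ℕ => gp u w (2 ^ n) (min (⌊r * 2 ^ n⌋₊) (2 ^ n))) atTop
      (𝓝[Set.Icc u w] t) :=
    tendsto_nhdsWithin_iff.2 ⟨hlim, Eventually.of_forall fun n =>
      gp_mem' huw.le (n, ⌊r * 2 ^ n⌋₊)⟩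
  refine ge_of_tendsto ((hc t ht).tendsto.comp hlim') (Eventually.of_forall fun n => ?_)
  exact ciInf_le (bdd huw.le hc) (n, ⌊r * 2 ^ n⌋₊)

lemma mn_attained {u w : ℝ} (huw : u < w) {ω : Ω}
    (hc : ContinuousOn (fun s => B s ω) (Set.Icc u w)) :
    ∃ t ∈ Set.Icc u w, B t ω = mn B u w ω := by
  obtain ⟨t, ht, hmin⟩ := isCompact_Icc.exists_isMinOn (Set.nonempty_Icc.2 huw.le) hc
  refine ⟨t, ht, le_antisymm ?_ (mn_le huw hc ht)⟩
  exact le_ciInf (fun p => hmin (gp_mem' huw.le p))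

lemma Mf_nonneg {u w : ℝ} (huw : u < w) (Y : Ω → ℝ) (N : ℕ) (hN : 0 < N) (ω : Ω) :
    0 ≤ Mf B Y u w N ω := by
  have hNr : (0 : ℝ) < N := by positivity
  exact Finset.prod_nonneg (fun i _ => gk_nonneg (div_pos (by linarith) hNr) _ _)

lemma Mf_le_one {u w : ℝ} (huw : u < w) (Y : Ω → ℝ) (N : ℕ) (hN : 0 < N) (ω : Ω) :
    Mf B Y u w N ω ≤ 1 := by
  have hNr : (0 : ℝ) < N := by positivity
  exact Finset.prod_le_one (fun i _ => gk_nonneg (div_pos (by linarith) hNr) _ _)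
    (fun i _ => gk_le_one _ _ _)

lemma Mf_meas (h : Bridge P t0 t1 x0 x1 B) {u w : ℝ} {Y : Ω → ℝ} (hY : Measurable Y) (N : ℕ) :
    Measurable (Mf B Y u w N) := by
  unfold Mf
  exact Finset.measurable_fun_prod _ (fun i hi => gk_meas _ ((h.meas _).sub hY) ((h.meas _).sub hY))

lemma Mf_lim_one {u w : ℝ} (huw : u < w) {Y : Ω → ℝ} {ω : Ω}
    (hc : ContinuousOn (fun s => B s ω) (Set.Icc u w)) (hY : Y ω < mn B u w ω) :
    Tendsto (fun n : ℕ => Mf B Y u w (2 ^ n) ω) atTop (𝓝 1) := by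
  set ε := mn B u w ω - Y ω with hε
  have hε0 : 0 < ε := by rw [hε]; linarith
  set q := 2 * ε * ε / (w - u) with hq
  have hq0 : 0 < q := div_pos (by positivity) (by linarith)
  have hlow : ∀ n : ℕ, 1 - ((2 ^ n : ℕ) : ℝ) * Real.exp (-(q * ((2 ^ n : ℕ) : ℝ))) ≤
      Mf B Y u w (2 ^ n) ω := by
    intro n
    set N : ℕ := 2 ^ n with hN
    have hN0 : 0 < N := by positivity
    have hNr : (0 : ℝ) < N := by positivity
    have hδ : 0 < (w - u) / N := div_pos (by linarith) hNr
    have e1 : Real.exp (-(q * N)) ≤ 1 := by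
      rw [Real.exp_le_one_iff]; nlinarith [mul_pos hq0 hNr]
    calc 1 - (N : ℝ) * Real.exp (-(q * N)) = 1 + (N : ℝ) * (- Real.exp (-(q * N))) := by ring
      _ ≤ (1 + (- Real.exp (-(q * N)))) ^ N :=
        one_add_mul_le_pow (by linarith) N
      _ = ∏ i ∈ Finset.range N, (1 + (- Real.exp (-(q * N)))) := by simp
      _ ≤ _ := by
        unfold Mf
        apply Finset.prod_le_prod
        · intro i _; linarith
        · intro i hi
          have hi' := Finset.mem_range.1 hi
          have := gk_lower (a := B (gp u w N i) ω - Y ω) (c := B (gp u w N (i + 1)) ω - Y ω)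
            hδ hε0.le
            (by linarith [mn_le huw hc (gp_mem huw.le N i hN0 hi'.le)])
            (by linarith [mn_le huw hc (gp_mem huw.le N (i + 1) hN0 hi')])
          have e : 2 * ε * ε / ((w - u) / N) = q * N := by
            have : w - u ≠ 0 := by linarith
            rw [hq]; field_simp
          rw [e] at this
          linarith
  have hN : Tendsto (fun n : ℕ => ((2 ^ n : ℕ) : ℝ)) atTop atTop := by
    push_cast
    exact tendsto_pow_atTop_atTop_of_one_lt (by norm_num : (1 : ℝ) < 2)
  have hx : Tendsto (fun x : ℝ => x * Real.exp (-(q * x))) atTop (𝓝 0) := by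
    have := Real.tendsto_pow_mul_exp_neg_atTop_nhds_zero 1
    have h2 := (this.comp (tendsto_id.const_mul_atTop hq0)).const_mul (1 / q)
    rw [mul_zero] at h2
    refine h2.congr (fun x => ?_)
    simp only [Function.comp, id, pow_one]
    field_simp
  have hl : Tendsto (fun n : ℕ => 1 - ((2 ^ n : ℕ) : ℝ) * Real.exp (-(q * ((2 ^ n : ℕ) : ℝ))))
      atTop (𝓝 1) := by
    simpa using (hx.comp hN).const_sub 1
  exact tendsto_of_tendsto_of_tendsto_of_le_of_le hl tendsto_const_nhds hlow
    (fun n => Mf_le_one huw Y _ (by positivity) ω)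

lemma Mf_lim_zero {u w : ℝ} {Y : Ω → ℝ} {ω : Ω} (hY : mn B u w ω < Y ω) :
    Tendsto (fun n : ℕ => Mf B Y u w (2 ^ n) ω) atTop (𝓝 0) := by
  obtain ⟨⟨n0, j⟩, hp⟩ := exists_lt_of_ciInf_lt hY
  simp only at hp
  set i0 := min j (2 ^ n0) with hi0
  have hi0' : i0 ≤ 2 ^ n0 := min_le_right _ _
  refine tendsto_const_nhds.congr' ?_
  filter_upwards [eventually_ge_atTop n0] with n hn
  symm
  obtain ⟨m, rfl⟩ := Nat.exists_eq_add_of_le hn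
  have hg : gp u w (2 ^ (n0 + m)) (i0 * 2 ^ m) = gp u w (2 ^ n0) i0 := by
    unfold gp; push_cast; rw [pow_add]; field_simp
  have hle : i0 * 2 ^ m ≤ 2 ^ (n0 + m) := by rw [pow_add]; gcongr
  rw [← hg] at hp
  set i := i0 * 2 ^ m
  unfold Mf
  rcases hle.lt_or_eq with hlt | heq
  · apply Finset.prod_eq_zero (Finset.mem_range.2 hlt)
    exact gk_left (by linarith)
  · have hpos : 0 < 2 ^ (n0 + m) := by positivity
    apply Finset.prod_eq_zero (i := i - 1) (Finset.mem_range.2 (by omega))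
    apply gk_right
    have : i - 1 + 1 = i := by omega
    rw [this]; linarith

lemma integrable_bd {f : Ω → ℝ} (hf : Measurable f) (h0 : ∀ ω, 0 ≤ f ω) (h1 : ∀ ω, f ω ≤ 1) :
    Integrable f P :=
  Integrable.of_bound (C := 1) hf.aestronglyMeasurable (Eventually.of_forall fun ω => by
    rw [Real.norm_eq_abs, abs_of_nonneg (h0 ω)]; exact h1 ω)

lemma law_lower (h : Bridge P t0 t1 x0 x1 B) {u w : ℝ} (h0 : t0 ≤ u) (huw : u < w) (h1 : w ≤ t1)
    {F : Ω → ℝ} (hF : Measurable[sig B t0 t1 u w] F) (hF0 : ∀ ω, 0 ≤ F ω) (hF1 : ∀ ω, F ω ≤ 1)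
    {Y : Ω → ℝ} (hY : Measurable[sig B t0 t1 u w] Y) :
    ∫ ω, F ω * (if Y ω < mn B u w ω then 1 else 0) ∂P ≤
      ∫ ω, F ω * gk (w - u) (B u ω - Y ω) (B w ω - Y ω) ∂P := by
  have hF' : Measurable F := hF.mono (h.sig_le u w) le_rfl
  have hY' : Measurable Y := hY.mono (h.sig_le u w) le_rfl
  have hmn : Measurable (mn B u w) := mn_meas huw.le (fun t _ => h.meas t)
  have hind : Measurable (fun ω => if Y ω < mn B u w ω then (1 : ℝ) else 0) :=
    Measurable.ite (measurableSet_lt hY' hmn) measurable_const measurable_const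
  have hlim : Tendsto (fun n : ℕ => ∫ ω, F ω * (if Y ω < mn B u w ω then 1 else 0) *
      Mf B Y u w (2 ^ n) ω ∂P) atTop
      (𝓝 (∫ ω, F ω * (if Y ω < mn B u w ω then 1 else 0) ∂P)) := by
    refine tendsto_integral_of_dominated_convergence (fun _ => 1)
      (fun n => ((hF'.mul hind).mul (h.Mf_meas hY' _)).aestronglyMeasurable)
      (integrable_const _) ?_ ?_
    · intro n
      refine Eventually.of_forall fun ω => ?_
      have a := Mf_nonneg (B := B) huw Y (2 ^ n) (by positivity) ω
      have b := Mf_le_one (B := B) huw Y (2 ^ n) (by positivity) ω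
      have := hF0 ω
      have := hF1 ω
      rw [Real.norm_eq_abs]
      split_ifs
      · rw [abs_of_nonneg (by positivity), mul_one]
        exact mul_le_one₀ (hF1 ω) a b
      · simp
    · filter_upwards [h.cont] with ω hω
      split_ifs with hc
      · have := (Mf_lim_one huw (hω.mono (Set.Icc_subset_Icc h0 h1)) hc).const_mul (F ω * 1)
        simpa using this
      · simp
  refine le_of_tendsto' hlim (fun n => ?_)
  rw [← h.grid h0 huw h1 hF hY hF0 hF1 (N := 2 ^ n) (by positivity)]
  have a := Mf_nonneg (B := B) huw Y (2 ^ n) (by positivity)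
  have b := Mf_le_one (B := B) huw Y (2 ^ n) (by positivity)
  refine integral_mono_of_nonneg (Eventually.of_forall fun ω => ?_)
    (integrable_bd (hF'.mul (h.Mf_meas hY' _)) (fun ω => mul_nonneg (hF0 ω) (a ω))
      (fun ω => mul_le_one₀ (hF1 ω) (a ω) (b ω))) (Eventually.of_forall fun ω => ?_)
  · have := a ω; have := hF0 ω
    simp only [Pi.zero_apply]; positivity
  · have := mul_nonneg (hF0 ω) (a ω)
    simp only
    split_ifs <;> simp [this]

lemma law_upper (h : Bridge P t0 t1 x0 x1 B) {u w : ℝ} (h0 : t0 ≤ u) (huw : u < w) (h1 : w ≤ t1)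
    {F : Ω → ℝ} (hF : Measurable[sig B t0 t1 u w] F) (hF0 : ∀ ω, 0 ≤ F ω) (hF1 : ∀ ω, F ω ≤ 1)
    {Y : Ω → ℝ} (hY : Measurable[sig B t0 t1 u w] Y) :
      ∫ ω, F ω * gk (w - u) (B u ω - Y ω) (B w ω - Y ω) ∂P ≤
    ∫ ω, F ω * (if Y ω ≤ mn B u w ω then 1 else 0) ∂P := by
  have hF' : Measurable F := hF.mono (h.sig_le u w) le_rfl
  have hY' : Measurable Y := hY.mono (h.sig_le u w) le_rfl
  have hmn : Measurable (mn B u w) := mn_meas huw.le (fun t _ => h.meas t)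
  have hind : Measurable (fun ω => if mn B u w ω < Y ω then (1 : ℝ) else 0) :=
    Measurable.ite (measurableSet_lt hmn hY') measurable_const measurable_const
  have hind' : Measurable (fun ω => if Y ω ≤ mn B u w ω then (1 : ℝ) else 0) :=
    Measurable.ite (measurableSet_le hY' hmn) measurable_const measurable_const
  have a := fun n : ℕ => Mf_nonneg (B := B) huw Y (2 ^ n) (by positivity)
  have b := fun n : ℕ => Mf_le_one (B := B) huw Y (2 ^ n) (by positivity)
  have hb0 : ∀ n ω, 0 ≤ F ω * (if mn B u w ω < Y ω then 1 else 0) * Mf B Y u w (2 ^ n) ω := by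
    intro n ω
    have := a n ω; have := hF0 ω
    positivity
  have hb1 : ∀ n ω, F ω * (if mn B u w ω < Y ω then 1 else 0) * Mf B Y u w (2 ^ n) ω ≤ 1 := by
    intro n ω
    split_ifs
    · rw [mul_one]
      exact mul_le_one₀ (hF1 ω) (a n ω) (b n ω)
    · simp
  have hlim : Tendsto (fun n : ℕ => ∫ ω, F ω * (if mn B u w ω < Y ω then 1 else 0) *
      Mf B Y u w (2 ^ n) ω ∂P) atTop (𝓝 (∫ ω, (0 : ℝ) ∂P)) := by
    refine tendsto_integral_of_dominated_convergence (fun _ => 1)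
      (fun n => ((hF'.mul hind).mul (h.Mf_meas hY' _)).aestronglyMeasurable)
      (integrable_const _) ?_ ?_
    · intro n
      refine Eventually.of_forall fun ω => ?_
      rw [Real.norm_eq_abs, abs_of_nonneg (hb0 n ω)]
      exact hb1 n ω
    · refine Eventually.of_forall fun ω => ?_
      split_ifs with hc
      · have := (Mf_lim_zero hc).const_mul (F ω * 1)
        simpa using this
      · simp
  have hlim2 := hlim.const_add (∫ ω, F ω * (if Y ω ≤ mn B u w ω then 1 else 0) ∂P)
  rw [integral_zero, add_zero] at hlim2
  refine ge_of_tendsto' hlim2 (fun n => ?_)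
  rw [← h.grid h0 huw h1 hF hY hF0 hF1 (N := 2 ^ n) (by positivity), ← integral_add]
  · apply integral_mono
    · exact integrable_bd (hF'.mul (h.Mf_meas hY' _)) (fun ω => mul_nonneg (hF0 ω) (a n ω))
        (fun ω => mul_le_one₀ (hF1 ω) (a n ω) (b n ω))
    · refine (integrable_bd (hF'.mul hind') ?_ ?_).add (integrable_bd
        ((hF'.mul hind).mul (h.Mf_meas hY' _)) (hb0 n) (hb1 n))
      · intro ω; have := hF0 ω; simp only [Pi.mul_apply]; positivity
      · intro ω; have := hF1 ω; simp only [Pi.mul_apply]; split_ifs <;> simp [this]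
    · intro ω
      simp only
      have := hF0 ω
      rcases le_or_gt (Y ω) (mn B u w ω) with hc | hc
      · simp only [hc, if_true, not_lt.2 hc, if_false, mul_one, mul_zero, zero_mul, add_zero]
        exact mul_le_of_le_one_right (hF0 ω) (b n ω)
      · simp [hc, not_le.2 hc]
  · refine (integrable_bd (hF'.mul hind') ?_ ?_)
    · intro ω; have := hF0 ω; positivity
    · intro ω; have := hF1 ω; split_ifs <;> simp [this]
  · exact integrable_bd ((hF'.mul hind).mul (h.Mf_meas hY' _)) (hb0 n) (hb1 n)

lemma gk_shift_lim (h : Bridge P t0 t1 x0 x1 B) {u w : ℝ} (h0 : t0 ≤ u) (huw : u < w) (h1 : w ≤ t1)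
    {F : Ω → ℝ} (hF : Measurable[sig B t0 t1 u w] F) (hF0 : ∀ ω, 0 ≤ F ω) (hF1 : ∀ ω, F ω ≤ 1)
    {Y : Ω → ℝ} (hY : Measurable[sig B t0 t1 u w] Y) {e : ℕ → ℝ}
    (he : Tendsto e atTop (𝓝 0)) :
    Tendsto (fun n => ∫ ω, F ω * gk (w - u) (B u ω - (Y ω + e n)) (B w ω - (Y ω + e n)) ∂P) atTop
      (𝓝 (∫ ω, F ω * gk (w - u) (B u ω - Y ω) (B w ω - Y ω) ∂P)) := by
  have hF' : Measurable F := hF.mono (h.sig_le u w) le_rfl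
  have hY' : Measurable Y := hY.mono (h.sig_le u w) le_rfl
  refine tendsto_integral_of_dominated_convergence (fun _ => 1)
      (fun n => (hF'.mul (gk_meas _ ((h.meas _).sub (hY'.add_const _))
        ((h.meas _).sub (hY'.add_const _)))).aestronglyMeasurable)
      (integrable_const _) ?_ ?_
  · intro n
    refine Eventually.of_forall fun ω => ?_
    have a := gk_nonneg (L := w - u) (by linarith) (B u ω - (Y ω + e n)) (B w ω - (Y ω + e n))
    rw [Real.norm_eq_abs, abs_of_nonneg (mul_nonneg (hF0 ω) a)]
    exact mul_le_one₀ (hF1 ω) a (gk_le_one _ _ _)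
  · refine Eventually.of_forall fun ω => ?_
    refine Tendsto.const_mul _ ?_
    have h1 : Tendsto (fun n => (B u ω - (Y ω + e n), B w ω - (Y ω + e n))) atTop
        (𝓝 (B u ω - (Y ω + 0), B w ω - (Y ω + 0))) :=
      ((he.const_add _).const_sub _).prodMk_nhds ((he.const_add _).const_sub _)
    rw [add_zero] at h1
    have hc := (gk_continuous (w - u)).tendsto (B u ω - Y ω, B w ω - Y ω)
    have h2 := Filter.Tendsto.comp hc h1
    exact h2

lemma law_lt (h : Bridge P t0 t1 x0 x1 B) {u w : ℝ} (h0 : t0 ≤ u) (huw : u < w) (h1 : w ≤ t1)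
    {F : Ω → ℝ} (hF : Measurable[sig B t0 t1 u w] F) (hF0 : ∀ ω, 0 ≤ F ω) (hF1 : ∀ ω, F ω ≤ 1)
    {Y : Ω → ℝ} (hY : Measurable[sig B t0 t1 u w] Y) :
    ∫ ω, F ω * (if Y ω < mn B u w ω then 1 else 0) ∂P =
      ∫ ω, F ω * gk (w - u) (B u ω - Y ω) (B w ω - Y ω) ∂P := by
  refine le_antisymm (h.law_lower h0 huw h1 hF hF0 hF1 hY) ?_
  have hF' : Measurable F := hF.mono (h.sig_le u w) le_rfl
  have hY' : Measurable Y := hY.mono (h.sig_le u w) le_rfl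
  have hmn : Measurable (mn B u w) := mn_meas huw.le (fun t _ => h.meas t)
  refine le_of_tendsto' (h.gk_shift_lim h0 huw h1 hF hF0 hF1 hY
    tendsto_one_div_add_atTop_nhds_zero_nat) (fun n => ?_)
  refine (h.law_upper h0 huw h1 hF hF0 hF1 (hY.add_const _)).trans ?_
  have hn : (0 : ℝ) < 1 / ((n : ℝ) + 1) := by positivity
  have hind : Measurable (fun ω => if Y ω < mn B u w ω then (1 : ℝ) else 0) :=
    Measurable.ite (measurableSet_lt hY' hmn) measurable_const measurable_const
  refine integral_mono_of_nonneg (Eventually.of_forall fun ω => ?_)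
    (integrable_bd (hF'.mul hind) (fun ω => ?_) (fun ω => ?_)) (Eventually.of_forall fun ω => ?_)
  · have := hF0 ω; simp only [Pi.zero_apply]; positivity
  · have := hF0 ω; positivity
  · have := hF1 ω; split_ifs <;> simp [this]
  · refine mul_le_mul_of_nonneg_left ?_ (hF0 ω)
    split_ifs with c1 c2
    · rfl
    · exact absurd (show Y ω < mn B u w ω by linarith) c2
    · norm_num
    · rfl

lemma law_le (h : Bridge P t0 t1 x0 x1 B) {u w : ℝ} (h0 : t0 ≤ u) (huw : u < w) (h1 : w ≤ t1)
    {F : Ω → ℝ} (hF : Measurable[sig B t0 t1 u w] F) (hF0 : ∀ ω, 0 ≤ F ω) (hF1 : ∀ ω, F ω ≤ 1)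
    {Y : Ω → ℝ} (hY : Measurable[sig B t0 t1 u w] Y) :
    ∫ ω, F ω * (if Y ω ≤ mn B u w ω then 1 else 0) ∂P =
      ∫ ω, F ω * gk (w - u) (B u ω - Y ω) (B w ω - Y ω) ∂P := by
  refine le_antisymm ?_ (h.law_upper h0 huw h1 hF hF0 hF1 hY)
  have hF' : Measurable F := hF.mono (h.sig_le u w) le_rfl
  have hY' : Measurable Y := hY.mono (h.sig_le u w) le_rfl
  have hmn : Measurable (mn B u w) := mn_meas huw.le (fun t _ => h.meas t)
  have he : Tendsto (fun n : ℕ => -(1 / ((n : ℝ) + 1))) atTop (𝓝 0) := by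
    simpa using (tendsto_one_div_add_atTop_nhds_zero_nat (𝕜 := ℝ)).neg
  refine ge_of_tendsto' (h.gk_shift_lim h0 huw h1 hF hF0 hF1 hY he) (fun n => ?_)
  refine le_trans ?_ (h.law_lower h0 huw h1 hF hF0 hF1 (hY.add_const _))
  have hn : (0 : ℝ) < 1 / ((n : ℝ) + 1) := by positivity
  have hind : Measurable (fun ω => if Y ω + -(1 / ((n : ℝ) + 1)) < mn B u w ω then (1 : ℝ) else 0) :=
    Measurable.ite (measurableSet_lt (hY'.add_const _) hmn) measurable_const measurable_const
  refine integral_mono_of_nonneg (Eventually.of_forall fun ω => ?_)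
    (integrable_bd (hF'.mul hind) (fun ω => ?_) (fun ω => ?_)) (Eventually.of_forall fun ω => ?_)
  · have := hF0 ω; simp only [Pi.zero_apply]; positivity
  · have := hF0 ω; positivity
  · have := hF1 ω; split_ifs <;> simp [this]
  · refine mul_le_mul_of_nonneg_left ?_ (hF0 ω)
    split_ifs with c1 c2
    · rfl
    · exact absurd (show Y ω + -(1 / ((n : ℝ) + 1)) < mn B u w ω by linarith) c2
    · norm_num
    · rfl

end Bridge
open MeasureTheory ProbabilityTheory Real

noncomputable def Ef (x : ℝ) : ℝ := ∫ u in (0 : ℝ)..x, Real.exp (-u ^ 2)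

lemma Ef_deriv (x : ℝ) : HasDerivAt Ef (Real.exp (-x ^ 2)) x := by
  have hc : Continuous (fun u : ℝ => Real.exp (-u ^ 2)) := by fun_prop
  exact intervalIntegral.integral_hasDerivAt_right (hc.intervalIntegrable _ _)
    (hc.stronglyMeasurableAtFilter _ _) hc.continuousAt

lemma Ef_lim : Filter.Tendsto Ef Filter.atTop (nhds (√π / 2)) := by
  have h1 := integral_gaussian_Ioi 1
  simp only [div_one, neg_mul, one_mul] at h1
  have hi : IntegrableOn (fun u : ℝ => Real.exp (-u ^ 2)) (Set.Ioi 0) := by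
    have := (integrable_exp_neg_mul_sq (b := 1) one_pos).integrableOn (s := Set.Ioi 0)
    simpa using this
  have := intervalIntegral_tendsto_integral_Ioi 0 hi Filter.tendsto_id
  rw [h1] at this
  exact this

/-- density for the case `x1 ≤ x0`. -/
noncomputable def dens (t0 t1 d s : ℝ) : ℝ :=
  (d / (t1 - t0) ^ ((3 : ℝ) / 2)) * Real.sqrt (2 / (Real.pi * ((t1 - s) / (s - t0)))) *
    Real.exp (-(d ^ 2 / (2 * (t1 - t0))) * ((t1 - s) / (s - t0))) +
  ((t1 - t0) - d ^ 2) / (t1 - t0) ^ 2 * (1 - (2 / Real.sqrt Real.pi) *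
    Ef (Real.sqrt (d ^ 2 / (2 * (t1 - t0)) * ((t1 - s) / (s - t0)))))

noncomputable def Fc (t0 t1 d s : ℝ) : ℝ :=
  ((s - t0) / (t1 - t0) + (t1 - s) * d ^ 2 / (t1 - t0) ^ 2) *
    (1 - 2 / √π * Ef (d / √(2 * (t1 - t0)) * √((t1 - s) / (s - t0)))) -
  d / (t1 - t0) ^ ((3 : ℝ) / 2) * √(2 / π) * ((s - t0) * √((t1 - s) / (s - t0))) *
    Real.exp (-(d / √(2 * (t1 - t0)) * √((t1 - s) / (s - t0))) ^ 2)

lemma Fc_deriv {t0 t1 d s : ℝ} (hd : 0 ≤ d) (h0 : t0 < s) (h1 : s < t1) :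
    HasDerivAt (Fc t0 t1 d) (dens t0 t1 d s) s := by
  have hτ : 0 < s - t0 := by linarith
  have hρ : 0 < t1 - s := by linarith
  have hl : 0 < t1 - t0 := by linarith
  set l := t1 - t0 with hl'
  have hh : HasDerivAt (fun s => (t1 - s) / (s - t0)) (-l / (s - t0) ^ 2) s := by
    have := ((hasDerivAt_id s).const_sub t1).div ((hasDerivAt_id s).sub_const t0) hτ.ne'
    refine this.congr_deriv ?_
    simp only [id]; rw [hl']; ring
  have hpos : 0 < (t1 - s) / (s - t0) := div_pos hρ hτ
  have hr := hh.sqrt hpos.ne'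
  set r := √((t1 - s) / (s - t0)) with hrd
  have hr0 : 0 < r := Real.sqrt_pos.2 hpos
  have hr2 : (t1 - s) / (s - t0) = r ^ 2 := (Real.sq_sqrt hpos.le).symm
  have hkr := hr.const_mul (d / √(2 * l))
  have hE := (Ef_deriv (d / √(2 * l) * r)).comp s hkr
  have hX := ((hkr.fun_pow 2).fun_neg).exp
  have hA := ((hE.const_mul (2 / √π)).const_sub 1)
  have hB : HasDerivAt (fun s => (s - t0) / l + (t1 - s) * d ^ 2 / l ^ 2) (1 / l - d ^ 2 / l ^ 2) s := by
    have := (((hasDerivAt_id s).sub_const t0).div_const l).add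
      ((((hasDerivAt_id s).const_sub t1).mul_const (d ^ 2)).div_const (l ^ 2))
    refine this.congr_deriv ?_
    ring
  have hC := (((hasDerivAt_id s).sub_const t0).fun_mul hr).const_mul (d / l ^ ((3 : ℝ) / 2) * √(2 / π))
  have hF := (hB.mul hA).sub (hC.mul hX)
  have hmain : HasDerivAt (Fc t0 t1 d) _ s := hF
  refine hmain.congr_deriv ?_
  clear hmain hF hC hB hA hX hE hkr hr hh
  unfold dens
  have e1 : √(d ^ 2 / (2 * l) * ((t1 - s) / (s - t0))) = d / √(2 * l) * r := by
    rw [Real.sqrt_mul (by positivity), Real.sqrt_div (by positivity), Real.sqrt_sq hd]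
  have e2 : √(2 / (π * ((t1 - s) / (s - t0)))) = √(2 / π) / r := by
    rw [← div_div, Real.sqrt_div (by positivity)]
  have hl2 : √(2 * l) ^ 2 = 2 * l := Real.sq_sqrt (by positivity)
  have e3 : -(d ^ 2 / (2 * l)) * ((t1 - s) / (s - t0)) = -(d / √(2 * l) * r) ^ 2 := by
    rw [mul_pow, div_pow, hl2, hr2]; ring
  have e4 : l ^ ((3 : ℝ) / 2) = l * √l := by
    rw [show (3 : ℝ) / 2 = 1 + 1 / 2 by norm_num, Real.rpow_add hl, Real.rpow_one, Real.sqrt_eq_rpow]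
  rw [← hl', e1, e2, e3, e4]
  simp only [id, pow_one, Nat.cast_ofNat, show 2 - 1 = 1 from rfl, Function.comp, ← hrd]
  have hτr : t1 - s = r ^ 2 * (s - t0) := by rw [← hr2]; field_simp
  have hlr : l = (1 + r ^ 2) * (s - t0) := by rw [hl']; linarith
  have e5 : √(2 * l) = √2 * √l := Real.sqrt_mul (by norm_num) _
  have e6 : √(2 / π) = √2 / √π := Real.sqrt_div (by norm_num) _
  rw [e5] at *
  rw [e6, hτr]
  have s2 : √2 ^ 2 = 2 := Real.sq_sqrt (by norm_num)
  have sl : √l ^ 2 = l := Real.sq_sqrt hl.le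
  have sl0 : 0 < √l := Real.sqrt_pos.2 hl
  have sp0 : 0 < √π := Real.sqrt_pos.2 Real.pi_pos
  have s20 : 0 < √2 := by positivity
  generalize Real.exp (-(d / (√2 * √l) * r) ^ 2) = X
  generalize Ef (d / (√2 * √l) * r) = E
  generalize s - t0 = τ at *
  generalize √π = p at *
  generalize √2 = q at *
  generalize √l = m at *
  clear hl2 e1 e2 e3 e4 e5 e6 hrd hr2 hpos
  have hm : m ^ 2 = (1 + r ^ 2) * τ := by rw [sl, hlr]
  clear_value r l
  subst hlr
  have hne : (1 + r ^ 2) ≠ 0 := by positivity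
  field_simp
  linear_combination (2 * (1 + r ^ 2) * r ^ 2 * d ^ 3 * X) * hm -
    ((1 + r ^ 2) ^ 2 * τ * d * X * m ^ 2) * s2

lemma integral_closed {a V c : ℝ} (hV : 0 < V) (hc : 0 ≤ c) :
    ∫⁻ σ in Set.Ioi (0 : ℝ), ENNReal.ofReal (c * σ ^ 2 * gaussianPDFReal (-a) V.toNNReal σ) =
     ENNReal.ofReal (c * ((V + a ^ 2) / 2 * (1 - 2 / √π * Ef (a / √(2 * V))) -
        V * a * ((√(2 * π * V))⁻¹ * Real.exp (- a ^ 2 / (2 * V))))) ∧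
     0 ≤ c * ((V + a ^ 2) / 2 * (1 - 2 / √π * Ef (a / √(2 * V))) -
        V * a * ((√(2 * π * V))⁻¹ * Real.exp (- a ^ 2 / (2 * V)))) := by
  set N := fun σ : ℝ => (√(2 * π * V))⁻¹ * Real.exp (- (σ + a) ^ 2 / (2 * V)) with hN
  have hNN : gaussianPDFReal (-a) V.toNNReal = N := by
    ext σ
    rw [gaussianPDFReal, hN, Real.coe_toNNReal _ hV.le, sub_neg_eq_add]
  rw [hNN]
  set Φ := fun σ : ℝ => c * (-V * ((σ - a) * N σ) + (V + a ^ 2) * ((√π)⁻¹ * Ef ((σ + a) / √(2 * V)))) with hΦ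
  have s2V : √(2 * V) ^ 2 = 2 * V := Real.sq_sqrt (by positivity)
  have hNd : ∀ σ, HasDerivAt N (-(σ + a) / V * N σ) σ := by
    intro σ
    have h1 : HasDerivAt (fun σ : ℝ => - (σ + a) ^ 2 / (2 * V)) (-(σ + a) / V) σ := by
      have := ((((hasDerivAt_id σ).add_const a).fun_pow 2).fun_neg).div_const (2 * V)
      refine this.congr_deriv ?_
      simp only [id]
      field_simp
      push_cast
      ring
    have := h1.exp.const_mul ((√(2 * π * V))⁻¹)
    refine this.congr_deriv ?_
    rw [hN]; ring
  have hEd : ∀ σ, HasDerivAt (fun σ => (√π)⁻¹ * Ef ((σ + a) / √(2 * V))) (N σ) σ := by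
    intro σ
    have h1 : HasDerivAt (fun σ : ℝ => (σ + a) / √(2 * V)) (1 / √(2 * V)) σ :=
      ((hasDerivAt_id σ).add_const a).div_const _
    have := ((Ef_deriv ((σ + a) / √(2 * V))).comp σ h1).const_mul ((√π)⁻¹)
    refine this.congr_deriv ?_
    rw [hN]
    simp only
    rw [div_pow, s2V, show 2 * π * V = π * (2 * V) by ring, Real.sqrt_mul (x := π) (by positivity),
      neg_div, mul_inv]
    ring
  have hΦd : ∀ σ, HasDerivAt Φ (c * σ ^ 2 * N σ) σ := by
    intro σ
    have h1 := ((((hasDerivAt_id σ).sub_const a).fun_mul (hNd σ)).const_mul (-V)).fun_add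
      ((hEd σ).const_mul (V + a ^ 2))
    have := h1.const_mul c
    refine this.congr_deriv ?_
    simp only [id]
    field_simp
    ring
  have hNpos : ∀ σ, 0 ≤ N σ := fun σ => by rw [hN]; positivity
  have hlimE : Filter.Tendsto (fun σ => (√π)⁻¹ * Ef ((σ + a) / √(2 * V))) Filter.atTop (nhds (1 / 2)) := by
    have h1 : Filter.Tendsto (fun σ : ℝ => (σ + a) / √(2 * V)) Filter.atTop Filter.atTop :=
      (Filter.tendsto_atTop_add_const_right _ _ Filter.tendsto_id).atTop_div_const (by positivity)
    have := (Ef_lim.comp h1).const_mul ((√π)⁻¹)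
    have hp : √π ≠ 0 := (Real.sqrt_pos.2 Real.pi_pos).ne'
    rwa [show (√π)⁻¹ * (√π / 2) = 1 / 2 by field_simp] at this
  have hlimN : Filter.Tendsto (fun σ => (σ - a) * N σ) Filter.atTop (nhds 0) := by
    have hb : 0 < 1 / (2 * V) := by positivity
    have he : Filter.Tendsto (fun x : ℝ => Real.exp (-(1 / 2) * x)) Filter.atTop (nhds 0) := by
      refine Real.tendsto_exp_atBot.comp ?_
      exact Filter.tendsto_id.const_mul_atTop_of_neg (by norm_num)
    have l1 := (rpow_mul_exp_neg_mul_sq_isLittleO_exp_neg hb 1).trans_tendsto he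
    have l0 := (rpow_mul_exp_neg_mul_sq_isLittleO_exp_neg hb 0).trans_tendsto he
    have hs : Filter.Tendsto (fun σ : ℝ => σ + a) Filter.atTop Filter.atTop :=
      Filter.tendsto_atTop_add_const_right _ _ Filter.tendsto_id
    have := (((l1.sub (l0.const_mul (2 * a))).comp hs).const_mul ((√(2 * π * V))⁻¹))
    simp only [Real.rpow_one, Real.rpow_zero, mul_zero, sub_zero] at this
    refine this.congr (fun σ => ?_)
    simp only [Function.comp, hN]
    rw [show -(1 / (2 * V)) * (σ + a) ^ 2 = -(σ + a) ^ 2 / (2 * V) by ring]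
    ring
  have hlim : Filter.Tendsto Φ Filter.atTop (nhds (c * ((V + a ^ 2) * (1 / 2)))) := by
    have := ((hlimN.const_mul (-V)).add (hlimE.const_mul (V + a ^ 2))).const_mul c
    rwa [mul_zero, zero_add] at this
  have hint := integrableOn_Ioi_deriv_of_nonneg' (a := 0) (fun σ _ => hΦd σ)
    (fun σ _ => by have := hNpos σ; positivity) hlim
  have hval := integral_Ioi_of_hasDerivAt_of_nonneg' (a := 0) (fun σ _ => hΦd σ)
    (fun σ _ => by have := hNpos σ; positivity) hlim
  have heq : c * ((V + a ^ 2) * (1 / 2)) - Φ 0 =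
      c * ((V + a ^ 2) / 2 * (1 - 2 / √π * Ef (a / √(2 * V))) -
        V * a * ((√(2 * π * V))⁻¹ * Real.exp (- a ^ 2 / (2 * V)))) := by
    rw [hΦ, hN]
    simp only [zero_add, zero_sub]
    ring
  have hnn : ∀ σ, 0 ≤ c * σ ^ 2 * N σ := fun σ => by have := hNpos σ; positivity
  rw [heq] at hval
  refine ⟨?_, ?_⟩
  · rw [← ofReal_integral_eq_lintegral_ofReal hint (Filter.Eventually.of_forall hnn), hval]
  · rw [← hval]
    exact integral_nonneg hnn
open MeasureTheory ProbabilityTheory Real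

lemma closed_eq_Fc {t0 t1 d s : ℝ} (h0 : t0 < s) (h1 : s < t1) :
    ∫⁻ σ in Set.Ioi (0 : ℝ), ENNReal.ofReal (2 / (t1 - s) * σ ^ 2 *
      gaussianPDFReal (-((t1 - s) * d / (t1 - t0))) ((s - t0) * (t1 - s) / (t1 - t0)).toNNReal σ) =
     ENNReal.ofReal (Fc t0 t1 d s) ∧ 0 ≤ Fc t0 t1 d s := by
  have hτ : 0 < s - t0 := by linarith
  have hρ : 0 < t1 - s := by linarith
  have hl : 0 < t1 - t0 := by linarith
  have hcl := integral_closed (a := (t1 - s) * d / (t1 - t0)) (V := (s - t0) * (t1 - s) / (t1 - t0))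
    (c := 2 / (t1 - s)) (by positivity) (by positivity)
  rw [hcl.1]
  suffices hs : _ = Fc t0 t1 d s from ⟨congrArg ENNReal.ofReal hs, hs ▸ hcl.2⟩
  clear hcl
  unfold Fc
  have e4 : (t1 - t0) ^ ((3 : ℝ) / 2) = (t1 - t0) * √(t1 - t0) := by
    rw [show (3 : ℝ) / 2 = 1 + 1 / 2 by norm_num, Real.rpow_add hl, Real.rpow_one, Real.sqrt_eq_rpow]
  rw [e4]
  generalize s - t0 = τ at *
  generalize t1 - s = ρ at *
  generalize t1 - t0 = l at *
  have e1 : √(2 * (τ * ρ / l)) = √2 * (√τ * √ρ) / √l := by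
    rw [Real.sqrt_mul (by norm_num), Real.sqrt_div (by positivity), Real.sqrt_mul hτ.le]; ring
  have e2 : √(2 * π * (τ * ρ / l)) = √2 * √π * (√τ * √ρ) / √l := by
    rw [Real.sqrt_mul (by positivity), Real.sqrt_mul (by norm_num), Real.sqrt_div (by positivity),
      Real.sqrt_mul hτ.le]; ring
  have e5 : √(2 * l) = √2 * √l := Real.sqrt_mul (by norm_num) _
  have e6 : √(2 / π) = √2 / √π := Real.sqrt_div (by norm_num) _
  have e7 : √(ρ / τ) = √ρ / √τ := Real.sqrt_div hρ.le _
  have s2 : √2 ^ 2 = 2 := Real.sq_sqrt (by norm_num)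
  have sl : √l ^ 2 = l := Real.sq_sqrt hl.le
  have st : √τ ^ 2 = τ := Real.sq_sqrt hτ.le
  have sr : √ρ ^ 2 = ρ := Real.sq_sqrt hρ.le
  have sl0 : 0 < √l := Real.sqrt_pos.2 hl
  have st0 : 0 < √τ := Real.sqrt_pos.2 hτ
  have sr0 : 0 < √ρ := Real.sqrt_pos.2 hρ
  have sp0 : 0 < √π := Real.sqrt_pos.2 Real.pi_pos
  have s20 : 0 < √2 := by positivity
  have hexp : -(ρ * d / l) ^ 2 / (2 * (τ * ρ / l)) = -(d / (√2 * √l) * (√ρ / √τ)) ^ 2 := by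
    simp only [mul_pow, div_pow, s2, sl, st, sr]
    field_simp
  rw [hexp, e1, e2, e5, e6, e7]
  have e8 : ρ * d / l / (√2 * (√τ * √ρ) / √l) = d / (√2 * √l) * (√ρ / √τ) := by
    field_simp
    rw [sl, sr]
    ring
  rw [e8]
  generalize Real.exp (-(d / (√2 * √l) * (√ρ / √τ)) ^ 2) = X
  generalize Ef (d / (√2 * √l) * (√ρ / √τ)) = E
  generalize √π = p at *
  generalize √2 = q at *
  clear hexp e1 e2 e4 e5 e6 e7 e8
  generalize √l = m at *
  generalize √τ = n at *
  generalize √ρ = k at *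
  subst sl st sr
  field_simp
  linear_combination (d * X * n * k * m) * s2

namespace Bridge
variable {Ω : Type*} [MeasurableSpace Ω] {P : Measure Ω} [IsProbabilityMeasure P]
  {t0 t1 x0 x1 : ℝ} {B : ℝ → Ω → ℝ}

lemma ae_left (h : Bridge P t0 t1 x0 x1 B) : ∀ᵐ ω ∂P, B t0 ω = x0 := by
  have := h.law (s := t0) ⟨le_rfl, h.lt.le⟩
  simp only [sub_self, zero_div, zero_mul, add_zero, Real.toNNReal_zero, gaussianReal_zero_var] at this
  have h2 : ∀ᵐ x ∂(P.map (B t0)), x = x0 := by rw [this, ae_dirac_eq]; simp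
  exact ae_of_ae_map (h.meas _).aemeasurable h2

lemma ae_right (h : Bridge P t0 t1 x0 x1 B) : ∀ᵐ ω ∂P, B t1 ω = x1 := by
  have := h.law (s := t1) ⟨h.lt.le, le_rfl⟩
  have hl : t1 - t0 ≠ 0 := by have := h.lt; intro; linarith
  simp only [sub_self, zero_div, mul_zero, div_self hl, one_mul, add_sub_cancel, Real.toNNReal_zero, gaussianReal_zero_var] at this
  have h2 : ∀ᵐ x ∂(P.map (B t1)), x = x1 := by rw [this, ae_dirac_eq]; simp
  exact ae_of_ae_map (h.meas _).aemeasurable h2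

/-- The kernel appearing in the layer-cake formula. -/
noncomputable def Dk (ρ x1 z y : ℝ) : ℝ :=
  if y < z ∧ y < x1 then 2 * (z + x1 - 2 * y) / ρ * Real.exp (-(2 * (z - y) * (x1 - y) / ρ)) else 0

lemma Dk_meas (ρ x1 : ℝ) : Measurable (fun p : ℝ × ℝ => Dk ρ x1 p.1 p.2) := by
  unfold Dk
  refine Measurable.ite ?_ (by fun_prop) measurable_const
  exact (measurableSet_lt measurable_snd measurable_fst).inter
    (measurableSet_lt measurable_snd measurable_const)

lemma Dk_nonneg {ρ : ℝ} (hρ : 0 < ρ) (x1 z y : ℝ) : 0 ≤ Dk ρ x1 z y := by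
  unfold Dk
  split_ifs with hc
  · have : 0 < z + x1 - 2 * y := by linarith [hc.1, hc.2]
    positivity
  · rfl

lemma layer {ρ : ℝ} (hρ : 0 < ρ) (x1 z m : ℝ) :
    ENNReal.ofReal (gk ρ (z - m) (x1 - m)) =
      ∫⁻ y, (if m < y then 1 else 0) * ENNReal.ofReal (Dk ρ x1 z y) := by
  have e1 : ∀ y, (if m < y then 1 else 0) * ENNReal.ofReal (Dk ρ x1 z y) =
      (Set.Ioo m (min z x1)).indicator (fun y => ENNReal.ofReal
        (2 * (z + x1 - 2 * y) / ρ * Real.exp (-(2 * (z - y) * (x1 - y) / ρ)))) y := by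
    intro y
    by_cases h1 : m < y <;> by_cases h2 : y < z ∧ y < x1 <;> simp [Dk, h1, h2, Set.indicator]
  simp_rw [e1]
  rw [lintegral_indicator measurableSet_Ioo]
  rcases le_or_gt (min z x1) m with hm | hm
  · rw [Set.Ioo_eq_empty (not_lt.2 hm)]
    simp only [Measure.restrict_empty, lintegral_zero_measure]
    rcases min_le_iff.1 hm with h | h
    · rw [gk_left (by linarith), ENNReal.ofReal_zero]
    · rw [gk_right (by linarith), ENNReal.ofReal_zero]
  · have hz : m < z := hm.trans_le (min_le_left _ _)
    have hx : m < x1 := hm.trans_le (min_le_right _ _)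
    set g := fun y : ℝ => 2 * (z + x1 - 2 * y) / ρ * Real.exp (-(2 * (z - y) * (x1 - y) / ρ)) with hg
    have hgc : Continuous g := by rw [hg]; fun_prop
    have hd : ∀ y, HasDerivAt (fun y => Real.exp (-(2 * (z - y) * (x1 - y) / ρ))) (g y) y := by
      intro y
      have := ((((((hasDerivAt_id y).const_sub z).const_mul 2).fun_mul
        ((hasDerivAt_id y).const_sub x1)).div_const ρ).fun_neg).exp
      refine this.congr_deriv ?_
      simp only [hg, id]
      ring
    have hI := intervalIntegral.integral_eq_sub_of_hasDerivAt (a := m) (b := min z x1)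
      (fun y _ => hd y) (hgc.intervalIntegrable _ _)
    rw [intervalIntegral.integral_of_le hm.le, integral_Ioc_eq_integral_Ioo] at hI
    rw [← ofReal_integral_eq_lintegral_ofReal, hI]
    · congr 1
      rw [gk_pos (by linarith) (by linarith)]
      have : (z - min z x1) * (x1 - min z x1) = 0 := by
        rcases min_choice z x1 with h | h <;> rw [h] <;> ring
      rw [show 2 * (z - min z x1) * (x1 - min z x1) / ρ = 2 * ((z - min z x1) * (x1 - min z x1)) / ρ by ring,
        this]
      simp
    · exact (hgc.integrableOn_Icc (a := m) (b := min z x1)).mono_set Set.Ioo_subset_Icc_self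
    · refine (ae_restrict_iff' measurableSet_Ioo).2 (Filter.Eventually.of_forall fun y hy => ?_)
      have h1 : y < z := hy.2.trans_le (min_le_left _ _)
      have h2 : y < x1 := hy.2.trans_le (min_le_right _ _)
      have : 0 < z + x1 - 2 * y := by linarith
      simp only [Pi.zero_apply]
      positivity

/-- joint law of the left minimum and `B s`. -/
lemma joint (h : Bridge P t0 t1 x0 x1 B) {s : ℝ} (h0 : t0 < s) (h1 : s < t1) (y : ℝ) :
    (P.restrict {ω | mn B t0 s ω < y}).map (B s) =
      (P.map (B s)).withDensity (fun z => ENNReal.ofReal (1 - gk (s - t0) (x0 - y) (z - y))) := by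
  have hmn : Measurable (mn B t0 s) := mn_meas h0.le (fun t _ => h.meas t)
  have hgm : Measurable (fun z => gk (s - t0) (x0 - y) (z - y)) :=
    gk_meas _ measurable_const (measurable_id.sub_const y)
  have hset : MeasurableSet {ω | mn B t0 s ω < y} := measurableSet_lt hmn measurable_const
  ext A hA
  rw [Measure.map_apply (h.meas s) hA, Measure.restrict_apply ((h.meas s) hA),
    withDensity_apply _ hA, setLIntegral_map hA (by fun_prop) (h.meas s)]
  set F : Ω → ℝ := fun ω => A.indicator (fun _ => 1) (B s ω) with hFd
  have hsm : Measurable[sig B t0 t1 t0 s] (B s) :=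
    meas_sig (Or.inr ⟨le_rfl, h1.le⟩)
  have hF : Measurable[sig B t0 t1 t0 s] F :=
    (measurable_const.indicator hA : Measurable (A.indicator (fun _ => (1 : ℝ)))).comp hsm
  have hF0 : ∀ ω, 0 ≤ F ω := fun ω => Set.indicator_nonneg (by simp) _
  have hF1 : ∀ ω, F ω ≤ 1 := fun ω => by
    by_cases c : B s ω ∈ A <;> simp [hFd, c]
  have key := h.law_le (le_refl t0) h0 h1.le hF hF0 hF1 (Y := fun _ => y)
    (@measurable_const _ _ _ (_) y)
  have hF' : Measurable F := hF.mono (h.sig_le _ _) le_rfl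
  have hg0 : ∀ z, 0 ≤ gk (s - t0) (x0 - y) (z - y) := fun z => gk_nonneg (by linarith) _ _
  have hg1 : ∀ z, gk (s - t0) (x0 - y) (z - y) ≤ 1 := fun z => gk_le_one _ _ _
  have key2 : ∫ ω, F ω * gk (s - t0) (B t0 ω - y) (B s ω - y) ∂P =
      ∫ ω, F ω * gk (s - t0) (x0 - y) (B s ω - y) ∂P := by
    refine integral_congr_ae ?_
    filter_upwards [h.ae_left] with ω hω
    rw [hω]
  rw [key2] at key
  have hFi : Integrable F P := integrable_bd hF' hF0 hF1
  have hgi : Integrable (fun ω => F ω * gk (s - t0) (x0 - y) (B s ω - y)) P :=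
    integrable_bd (hF'.mul (hgm.comp (h.meas s))) (fun ω => mul_nonneg (hF0 ω) (hg0 _))
      (fun ω => mul_le_one₀ (hF1 ω) (hg0 _) (hg1 _))
  have hind : Measurable (fun ω => if y ≤ mn B t0 s ω then (1 : ℝ) else 0) :=
    Measurable.ite (measurableSet_le measurable_const hmn) measurable_const measurable_const
  have hii : Integrable (fun ω => F ω * (if y ≤ mn B t0 s ω then 1 else 0)) P := by
    refine integrable_bd (hF'.mul hind) (fun ω => ?_) (fun ω => ?_)
    · have := hF0 ω; positivity
    · have := hF1 ω; split_ifs <;> simp [this]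
  have e1 : ∫ ω, (F ω - F ω * (if y ≤ mn B t0 s ω then 1 else 0)) ∂P =
      ∫ ω, (F ω - F ω * gk (s - t0) (x0 - y) (B s ω - y)) ∂P := by
    rw [integral_sub hFi hii, integral_sub hFi hgi, key]
  have e2 := congrArg ENNReal.ofReal e1
  rw [ofReal_integral_eq_lintegral_ofReal (hFi.sub' hii),
    ofReal_integral_eq_lintegral_ofReal (hFi.sub' hgi)] at e2
  · rw [← lintegral_indicator ((h.meas s) hA)]
    rw [← lintegral_indicator_one (((h.meas s) hA).inter hset)]
    refine Eq.trans ?_ (e2.trans ?_)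
    · refine lintegral_congr fun ω => ?_
      by_cases c1 : B s ω ∈ A <;> by_cases c2 : mn B t0 s ω < y <;>
        simp [hFd, c1, c2, Set.indicator, not_lt.1, not_le.2]
    · refine lintegral_congr fun ω => ?_
      by_cases c1 : B s ω ∈ A <;> simp [hFd, c1, Set.indicator]
  · refine Filter.Eventually.of_forall fun ω => ?_
    have := mul_le_of_le_one_right (hF0 ω) (hg1 (B s ω))
    simp only [Pi.zero_apply]; linarith
  · refine Filter.Eventually.of_forall fun ω => ?_
    have := hF0 ω
    simp only [Pi.zero_apply]; split_ifs <;> simp [this]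

end Bridge
open MeasureTheory ProbabilityTheory Real

namespace Bridge
variable {Ω : Type*} [MeasurableSpace Ω] {P : Measure Ω} [IsProbabilityMeasure P]
  {t0 t1 x0 x1 : ℝ} {B : ℝ → Ω → ℝ}

lemma exp_identity {τ ρ x0 x1 y z : ℝ} (hτ : 0 < τ) (hρ : 0 < ρ) (hx : x1 ≤ x0)
     (hz : y < z) (hy : y < x1) :
    (Dk ρ x1 z y) * (1 - gk τ (x0 - y) (z - y)) *
      gaussianPDFReal (x0 + τ / (τ + ρ) * (x1 - x0)) (τ * ρ / (τ + ρ)).toNNReal z =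
    2 / ρ * (z + x1 - 2 * y) * gaussianPDFReal (-(ρ * (x0 - x1) / (τ + ρ))) (τ * ρ / (τ + ρ)).toNNReal
      (z + x1 - 2 * y) := by
  have hl : 0 < τ + ρ := by positivity
  rw [gk_pos (by linarith) (by linarith), Dk, if_pos ⟨hz, hy⟩]
  simp only [gaussianPDFReal, Real.coe_toNNReal _ (show 0 ≤ τ * ρ / (τ + ρ) by positivity)]
  rw [sub_sub_cancel]
  have : Real.exp (-(2 * (z - y) * (x1 - y) / ρ)) * Real.exp (-(2 * (x0 - y) * (z - y) / τ)) *
      Real.exp (-(z - (x0 + τ / (τ + ρ) * (x1 - x0))) ^ 2 / (2 * (τ * ρ / (τ + ρ)))) =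
      Real.exp (-(z + x1 - 2 * y - -(ρ * (x0 - x1) / (τ + ρ))) ^ 2 / (2 * (τ * ρ / (τ + ρ)))) := by
    rw [← Real.exp_add, ← Real.exp_add]
    congr 1
    field_simp
    ring
  rw [← this]
  ring

lemma step1 (h : Bridge P t0 t1 x0 x1 B) {s : ℝ} (h0 : t0 < s) (h1 : s < t1) :
    P {ω | mn B t0 s ω < mn B s t1 ω} =
      ∫⁻ ω, ENNReal.ofReal (gk (t1 - s) (B s ω - mn B t0 s ω) (x1 - mn B t0 s ω)) ∂P := by
  have hY : Measurable[sig B t0 t1 s t1] (mn B t0 s) :=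
    mn_meas h0.le (fun t ht => meas_sig (Or.inl ht))
  have hm1 : Measurable (mn B t0 s) := mn_meas h0.le (fun t _ => h.meas t)
  have hm2 : Measurable (mn B s t1) := mn_meas h1.le (fun t _ => h.meas t)
  have key := h.law_lt h0.le h1 le_rfl (F := fun _ => 1) (@measurable_const _ _ _ (_) _)
    (by simp) (by simp) hY
  simp only [one_mul] at key
  have key2 : ∫ ω, gk (t1 - s) (B s ω - mn B t0 s ω) (B t1 ω - mn B t0 s ω) ∂P =
      ∫ ω, gk (t1 - s) (B s ω - mn B t0 s ω) (x1 - mn B t0 s ω) ∂P := by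
    refine integral_congr_ae ?_
    filter_upwards [h.ae_right] with ω hω
    rw [hω]
  rw [key2] at key
  have hset : MeasurableSet {ω | mn B t0 s ω < mn B s t1 ω} := measurableSet_lt hm1 hm2
  have hg0 : ∀ ω, 0 ≤ gk (t1 - s) (B s ω - mn B t0 s ω) (x1 - mn B t0 s ω) :=
    fun ω => gk_nonneg (by linarith) _ _
  rw [← ofReal_integral_eq_lintegral_ofReal _ (Filter.Eventually.of_forall hg0), ← key]
  · have : ∀ ω, (if mn B t0 s ω < mn B s t1 ω then (1 : ℝ) else 0) =
        Set.indicator {ω | mn B t0 s ω < mn B s t1 ω} 1 ω := fun ω => rfl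
    simp_rw [this]
    rw [integral_indicator_one hset, ofReal_measureReal]
  · exact integrable_bd (gk_meas _ ((h.meas s).sub hm1) (measurable_const.sub hm1)) hg0
      (fun ω => gk_le_one _ _ _)

lemma cdf_int (h : Bridge P t0 t1 x0 x1 B) (hx : x1 ≤ x0) {s : ℝ} (h0 : t0 < s) (h1 : s < t1) :
    P {ω | mn B t0 s ω < mn B s t1 ω} =
    ∫⁻ σ in Set.Ioi (0 : ℝ), ENNReal.ofReal (2 / (t1 - s) * σ ^ 2 *
      gaussianPDFReal (-((t1 - s) * (x0 - x1) / (t1 - t0)))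
        ((s - t0) * (t1 - s) / (t1 - t0)).toNNReal σ) := by
  have hτ : 0 < s - t0 := by linarith
  have hρ : 0 < t1 - s := by linarith
  have hm1 : Measurable (mn B t0 s) := mn_meas h0.le (fun t _ => h.meas t)
  have hV : 0 < (s - t0) * (t1 - s) / (t1 - t0) := div_pos (mul_pos hτ hρ) (by linarith)
  set V := ((s - t0) * (t1 - s) / (t1 - t0)).toNNReal with hVd
  have hV0 : V ≠ 0 := by rw [hVd]; simpa using hV
  set g : ℝ → ℝ := fun σ => 2 / (t1 - s) * σ *
      gaussianPDFReal (-((t1 - s) * (x0 - x1) / (t1 - t0))) V σ with hg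
  have hgm : Measurable g := by
    rw [hg]; exact (by fun_prop : Measurable fun σ : ℝ => 2 / (t1 - s) * σ).mul (measurable_gaussianPDFReal _ _)
  rw [h.step1 h0 h1]
  simp_rw [layer hρ]
  rw [lintegral_lintegral_swap]
  · have inner : ∀ y, ∫⁻ ω, (if mn B t0 s ω < y then 1 else 0) *
        ENNReal.ofReal (Dk (t1 - s) x1 (B s ω) y) ∂P =
        ∫⁻ z, (if y < z ∧ y < x1 then 1 else 0) * ENNReal.ofReal (g (z + x1 - 2 * y)) := by
      intro y
      have hset : MeasurableSet {ω | mn B t0 s ω < y} := measurableSet_lt hm1 measurable_const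
      have hDm : Measurable (fun z => ENNReal.ofReal (Dk (t1 - s) x1 z y)) :=
        ((Dk_meas (t1 - s) x1).comp (measurable_id.prodMk measurable_const)).ennreal_ofReal
      have hgkm : Measurable (fun z => ENNReal.ofReal (1 - gk (s - t0) (x0 - y) (z - y))) :=
        (measurable_const.sub (gk_meas _ measurable_const (measurable_id.sub_const y))).ennreal_ofReal
      have e1 : ∀ ω, (if mn B t0 s ω < y then 1 else 0) * ENNReal.ofReal (Dk (t1 - s) x1 (B s ω) y) =
          Set.indicator {ω | mn B t0 s ω < y} (fun ω => ENNReal.ofReal (Dk (t1 - s) x1 (B s ω) y)) ω := by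
        intro ω
        by_cases c : mn B t0 s ω < y <;> simp [c, Set.indicator]
      simp_rw [e1]
      rw [lintegral_indicator hset, ← lintegral_map (μ := P.restrict _) hDm (h.meas s),
        h.joint h0 h1, lintegral_withDensity_eq_lintegral_mul _ hgkm hDm, h.law ⟨h0.le, h1.le⟩,
        gaussianReal_of_var_ne_zero _ hV0,
        lintegral_withDensity_eq_lintegral_mul _ (measurable_gaussianPDF _ _) (hgkm.mul hDm)]
      refine lintegral_congr fun z => ?_
      simp only [Pi.mul_apply, gaussianPDF]
      by_cases c : y < z ∧ y < x1
      · rw [if_pos c, one_mul, hg]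
        have := exp_identity hτ hρ hx c.1 c.2
        rw [show s - t0 + (t1 - s) = t1 - t0 by ring, ← hVd] at this
        simp only
        rw [← this, ENNReal.ofReal_mul, ENNReal.ofReal_mul]
        · ring
        · exact Dk_nonneg hρ _ _ _
        · refine mul_nonneg (Dk_nonneg hρ _ _ _) ?_
          linarith [gk_le_one (s - t0) (x0 - y) (z - y)]
      · simp [Dk, c]
    simp_rw [inner]
    have shift : ∀ y, ∫⁻ z, (if y < z ∧ y < x1 then 1 else 0) * ENNReal.ofReal (g (z + x1 - 2 * y)) =
        ∫⁻ σ, (Set.Ioo (x1 - σ) x1).indicator 1 y * ENNReal.ofReal (g σ) := by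
      intro y
      rw [← lintegral_add_right_eq_self (μ := volume) (fun σ => (Set.Ioo (x1 - σ) x1).indicator 1 y * ENNReal.ofReal (g σ)) (x1 - 2 * y)]
      refine lintegral_congr fun z => ?_
      rw [show z + (x1 - 2 * y) = z + x1 - 2 * y by ring]
      congr 1
      simp only [Set.indicator, Set.mem_Ioo, Pi.one_apply]
      refine if_congr ?_ rfl rfl
      constructor <;> rintro ⟨a, b⟩ <;> constructor <;> linarith
    simp_rw [shift]
    rw [lintegral_lintegral_swap]
    · rw [← lintegral_indicator measurableSet_Ioi]
      refine lintegral_congr fun σ => ?_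
      rw [lintegral_mul_const _ (measurable_one.indicator measurableSet_Ioo),
        lintegral_indicator_one measurableSet_Ioo, Real.volume_Ioo, sub_sub_cancel]
      by_cases c : 0 < σ
      · rw [Set.indicator_of_mem (Set.mem_Ioi.2 c), ← ENNReal.ofReal_mul c.le]
        congr 1
        simp only [hg]; ring
      · rw [Set.indicator_of_notMem (by simpa using c), ENNReal.ofReal_of_nonpos (not_lt.1 c), zero_mul]
    · refine Measurable.aemeasurable ?_
      refine Measurable.mul ?_ (hgm.comp measurable_snd).ennreal_ofReal
      have : (fun p : ℝ × ℝ => (Set.Ioo (x1 - p.2) x1).indicator (1 : ℝ → ENNReal) p.1) =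
        Set.indicator {p : ℝ × ℝ | x1 - p.2 < p.1 ∧ p.1 < x1} 1 := by
        ext p; simp [Set.indicator]
      rw [this]
      exact measurable_one.indicator
        ((measurableSet_lt (measurable_const.sub measurable_snd) measurable_fst).inter
        (measurableSet_lt measurable_fst measurable_const))
  · refine Measurable.aemeasurable ?_
    refine Measurable.mul ?_ ((Dk_meas (t1 - s) x1).comp
      (((h.meas s).comp measurable_fst).prodMk measurable_snd)).ennreal_ofReal
    exact Measurable.ite (measurableSet_lt (hm1.comp measurable_fst) measurable_snd)
      measurable_const measurable_const

end Bridge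
open MeasureTheory ProbabilityTheory Real

open Filter Topology in
lemma endgame (μ : Measure ℝ) [IsProbabilityMeasure μ] {t0 t1 : ℝ} (ht : t0 < t1) {G f : ℝ → ℝ}
    (hsupp : ∀ᵐ s ∂μ, s ∈ Set.Icc t0 t1) (ha0 : μ {t0} = 0) (ha1 : μ {t1} = 0)
    (hG : ∀ s ∈ Set.Ioo t0 t1, μ (Set.Iio s) = ENNReal.ofReal (G s) ∧ 0 ≤ G s)
    (hd : ∀ s ∈ Set.Ioo t0 t1, HasDerivAt G (f s) s) :
    μ = volume.withDensity (fun s => ENNReal.ofReal (if t0 ≤ s ∧ s ≤ t1 then f s else 0)) := by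
  have hcG : ∀ s ∈ Set.Ioo t0 t1, cdf μ s = G s := by
    intro s hs
    have hr : ∀ s ∈ Set.Ioo t0 t1, μ.real (Set.Iio s) = G s := fun s hs => by
      rw [measureReal_def, (hG s hs).1, ENNReal.toReal_ofReal (hG s hs).2]
    rw [cdf_eq_real]
    refine le_antisymm ?_ ?_
    · have h1 : Tendsto G (𝓝[>] s) (𝓝 (G s)) := (hd s hs).continuousAt.continuousWithinAt
      refine ge_of_tendsto h1 ?_
      filter_upwards [Ioo_mem_nhdsGT hs.2] with r hr'
      rw [← hr r ⟨hs.1.trans hr'.1, hr'.2⟩]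
      exact measureReal_mono (Set.Iic_subset_Iio.2 hr'.1)
    · rw [← hr s hs]
      exact measureReal_mono Set.Iio_subset_Iic_self
  have hcd : ∀ s ∈ Set.Ioo t0 t1, HasDerivAt (cdf μ) (f s) s := by
    intro s hs
    refine (hd s hs).congr_of_eventuallyEq ?_
    filter_upwards [Ioo_mem_nhds hs.1 hs.2] with r hr using hcG r hr
  have hf0 : ∀ s ∈ Set.Ioo t0 t1, 0 ≤ f s := fun s hs => by
    rw [← (hcd s hs).deriv]; exact (monotone_cdf μ).deriv_nonneg
  have hcont : ContinuousOn (cdf μ) (Set.Icc t0 t1) := by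
    intro s hs
    rcases eq_or_lt_of_le hs.1 with h0 | h0
    · subst h0
      exact ((cdf μ).right_continuous _).mono Set.Icc_subset_Ici_self
    rcases eq_or_lt_of_le hs.2 with h1 | h1
    · subst h1
      have hl : ContinuousWithinAt (cdf μ) (Set.Iio s) s := by
        rw [(monotone_cdf μ).continuousWithinAt_Iio_iff_leftLim_eq]
        have := (cdf μ).measure_singleton s
        rw [measure_cdf, ha1] at this
        have h2 := (monotone_cdf μ).leftLim_le (le_refl s)
        have h3 := ENNReal.ofReal_eq_zero.1 this.symm
        linarith
      exact (continuousWithinAt_Iio_iff_Iic.1 hl).mono Set.Icc_subset_Iic_self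
    · exact (hcd s ⟨h0, h1⟩).continuousAt.continuousWithinAt
  have hIio : μ (Set.Iio t0) = 0 := by
    refine measure_mono_null ?_ (ae_iff.1 hsupp)
    intro s hs h; exact absurd h.1 (not_le.2 hs)
  have hIoi : μ (Set.Ioi t1) = 0 := by
    refine measure_mono_null ?_ (ae_iff.1 hsupp)
    intro s hs h; exact absurd h.2 (not_le.2 hs)
  have hIic0 : μ (Set.Iic t0) = 0 := by
    rw [← Set.Iio_union_right]
    exact measure_union_null hIio ha0
  have hc0 : cdf μ t0 = 0 := by rw [cdf_eq_real, measureReal_def, hIic0]; rfl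
  refine Measure.ext_of_Iic _ _ fun a => ?_
  rw [withDensity_apply _ measurableSet_Iic, ← lintegral_indicator measurableSet_Iic]
  have e1 : ∫⁻ s, (Set.Iic a).indicator (fun s => ENNReal.ofReal (if t0 ≤ s ∧ s ≤ t1 then f s else 0)) s =
      ∫⁻ s in Set.Ioc t0 (min a t1), ENNReal.ofReal (f s) := by
    rw [← lintegral_indicator measurableSet_Ioc]
    refine lintegral_congr_ae ?_
    have hne : ∀ᵐ s : ℝ ∂volume, s ≠ t0 := by
      simp [ae_iff]
    filter_upwards [hne] with s hs
    simp only [Set.indicator, Set.mem_Iic, Set.mem_Ioc, le_min_iff]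
    by_cases c1 : s ≤ a <;> by_cases c2 : s ≤ t1 <;> by_cases c3 : t0 ≤ s <;>
      simp [c1, c2, c3, lt_iff_le_and_ne, hs.symm]
  rw [e1]
  rcases lt_or_ge a t0 with h | h
  · rw [Set.Ioc_eq_empty (by simp [h.le]), measure_mono_null (Set.Iic_subset_Iic.2 h.le) hIic0]
    simp
  have hb : t0 ≤ min a t1 := le_min h ht.le
  have hb1 : min a t1 ≤ t1 := min_le_right _ _
  have hμ : μ (Set.Iic a) = μ (Set.Iic (min a t1)) := by
    rcases le_or_gt a t1 with h' | h'
    · rw [min_eq_left h']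
    · rw [min_eq_right h'.le]
      refine le_antisymm ?_ (measure_mono (Set.Iic_subset_Iic.2 h'.le))
      have : Set.Iic a ⊆ Set.Iic t1 ∪ Set.Ioi t1 := by simp
      refine (measure_mono this).trans ((measure_union_le _ _).trans ?_)
      rw [hIoi, add_zero]
  rw [hμ]
  generalize min a t1 = b at *
  have hint := intervalIntegral.integrableOn_deriv_of_nonneg (hcont.mono (Set.Icc_subset_Icc_right hb1))
    (fun x hx => hcd x ⟨hx.1, hx.2.trans_le hb1⟩) (fun x hx => hf0 x ⟨hx.1, hx.2.trans_le hb1⟩)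
  have hI := intervalIntegral.integral_eq_sub_of_hasDerivAt_of_le hb (hcont.mono (Set.Icc_subset_Icc_right hb1))
    (fun x hx => hcd x ⟨hx.1, hx.2.trans_le hb1⟩) ((intervalIntegrable_iff_integrableOn_Ioc_of_le hb).2 hint)
  rw [hc0, sub_zero, intervalIntegral.integral_of_le hb] at hI
  rw [← ofReal_integral_eq_lintegral_ofReal hint, hI, ofReal_cdf]
  have hne : ∀ᵐ s : ℝ ∂volume, s ≠ b := by simp [ae_iff]
  rw [Filter.EventuallyLE, ae_restrict_iff' measurableSet_Ioc]
  filter_upwards [hne] with s hs hs'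
  exact hf0 s ⟨hs'.1, (lt_of_le_of_ne hs'.2 hs).trans_le hb1⟩

namespace Bridge
variable {Ω : Type*} [MeasurableSpace Ω] {P : Measure Ω} [IsProbabilityMeasure P]
  {t0 t1 x0 x1 : ℝ} {B : ℝ → Ω → ℝ}

lemma no_atom (h : Bridge P t0 t1 x0 x1 B) {θ : Ω → ℝ} {e y : ℝ} (he : e ∈ Set.Icc t0 t1)
    (hy : ∀ᵐ ω ∂P, B e ω = y) (hey : e = t0 ∨ e = t1)
    (hθ : ∀ᵐ ω ∂P, θ ω ∈ Set.Icc t0 t1 ∧ IsMinOn (fun u => B u ω) (Set.Icc t0 t1) (θ ω)) :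
    P {ω | θ ω = e} = 0 := by
  have key := h.law_le (le_refl t0) h.lt le_rfl (F := fun _ => 1) (@measurable_const _ _ _ (_) _)
    (by simp) (by simp) (Y := fun _ => y) (@measurable_const _ _ _ (_) _)
  have hmn : Measurable (mn B t0 t1) := mn_meas h.lt.le (fun t _ => h.meas t)
  simp only [one_mul] at key
  have key2 : ∫ ω, gk (t1 - t0) (B t0 ω - y) (B t1 ω - y) ∂P = ∫ ω, (0 : ℝ) ∂P := by
    refine integral_congr_ae ?_
    filter_upwards [hy] with ω hω
    rcases hey with rfl | rfl
    · rw [hω]; exact gk_left (by simp)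
    · rw [hω]; exact gk_right (by simp)
  rw [key2, integral_zero] at key
  have hset : MeasurableSet {ω | y ≤ mn B t0 t1 ω} := measurableSet_le measurable_const hmn
  have : ∀ ω, (if y ≤ mn B t0 t1 ω then (1 : ℝ) else 0) =
        Set.indicator {ω | y ≤ mn B t0 t1 ω} 1 ω := fun ω => rfl
  simp_rw [this] at key
  rw [integral_indicator_one hset, measureReal_eq_zero_iff] at key
  refine measure_mono_null_ae ?_ key
  filter_upwards [hy, hθ, h.cont] with ω h1 h2 h3 h4
  obtain ⟨t, ht, hte⟩ := mn_attained h.lt h3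
  have h4' : θ ω = e := h4
  change y ≤ mn B t0 t1 ω
  rw [← hte, ← h1, ← h4']
  exact h2.2 ht

lemma event (h : Bridge P t0 t1 x0 x1 B) {s : ℝ} (h0 : t0 < s) (h1 : s < t1) {θ : Ω → ℝ}
    (huniq : ∀ᵐ ω ∂P, ∃! s, s ∈ Set.Icc t0 t1 ∧ IsMinOn (fun u => B u ω) (Set.Icc t0 t1) s)
    (hθ : ∀ᵐ ω ∂P, θ ω ∈ Set.Icc t0 t1 ∧ IsMinOn (fun u => B u ω) (Set.Icc t0 t1) (θ ω)) :
    P {ω | θ ω < s} = P {ω | mn B t0 s ω < mn B s t1 ω} := by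
  refine measure_congr ?_
  filter_upwards [huniq, hθ, h.cont] with ω hu ht hc
  have hc0 := hc.mono (Set.Icc_subset_Icc_right h1.le : Set.Icc t0 s ⊆ _)
  have hc1 := hc.mono (Set.Icc_subset_Icc_left h0.le : Set.Icc s t1 ⊆ _)
  refine propext ?_
  change θ ω < s ↔ mn B t0 s ω < mn B s t1 ω
  constructor
  · intro hlt
    have a1 := mn_le h0 hc0 (t := θ ω) ⟨ht.1.1, hlt.le⟩
    obtain ⟨t, htm, hte⟩ := mn_attained h1 hc1
    have a2 : B (θ ω) ω ≤ B t ω := ht.2 ⟨h0.le.trans htm.1, htm.2⟩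
    rw [← hte]
    refine lt_of_le_of_ne (a1.trans a2) (fun he => ?_)
    have : B t ω = B (θ ω) ω := le_antisymm (he ▸ a1) a2
    have h3 : t = θ ω := hu.unique ⟨⟨h0.le.trans htm.1, htm.2⟩, fun v hv => by
      change B t ω ≤ B v ω
      rw [this]; exact ht.2 hv⟩ ht
    linarith [htm.1]
  · intro hlt
    by_contra hge
    push Not at hge
    have a1 := mn_le h1 hc1 (t := θ ω) ⟨hge, ht.1.2⟩
    obtain ⟨t, htm, hte⟩ := mn_attained h0 hc0
    have a2 : B (θ ω) ω ≤ B t ω := ht.2 ⟨htm.1, htm.2.trans h1.le⟩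
    linarith

theorem core (h : Bridge P t0 t1 x0 x1 B) (hx : x1 ≤ x0) {θ : Ω → ℝ} (hθm : Measurable θ)
    (huniq : ∀ᵐ ω ∂P, ∃! s, s ∈ Set.Icc t0 t1 ∧ IsMinOn (fun u => B u ω) (Set.Icc t0 t1) s)
    (hθ : ∀ᵐ ω ∂P, θ ω ∈ Set.Icc t0 t1 ∧ IsMinOn (fun u => B u ω) (Set.Icc t0 t1) (θ ω)) :
    P.map θ = volume.withDensity (fun s => ENNReal.ofReal
      (if t0 ≤ s ∧ s ≤ t1 then dens t0 t1 (x0 - x1) s else 0)) := by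
  haveI : IsProbabilityMeasure (P.map θ) := Measure.isProbabilityMeasure_map hθm.aemeasurable
  refine endgame (P.map θ) h.lt (G := Fc t0 t1 (x0 - x1)) ?_ ?_ ?_ ?_ ?_
  · refine (ae_map_iff hθm.aemeasurable (p := fun s => s ∈ Set.Icc t0 t1) measurableSet_Icc).2 ?_
    filter_upwards [hθ] with ω hω using hω.1
  · rw [Measure.map_apply hθm (measurableSet_singleton _)]
    exact h.no_atom ⟨le_rfl, h.lt.le⟩ h.ae_left (Or.inl rfl) hθ
  · rw [Measure.map_apply hθm (measurableSet_singleton _)]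
    exact h.no_atom ⟨h.lt.le, le_rfl⟩ h.ae_right (Or.inr rfl) hθ
  · intro s hs
    have hcl := closed_eq_Fc (d := x0 - x1) hs.1 hs.2
    rw [Measure.map_apply hθm measurableSet_Iio]
    refine ⟨?_, hcl.2⟩
    rw [← hcl.1, ← h.cdf_int hx hs.1 hs.2]
    exact h.event hs.1 hs.2 huniq hθ
  · exact fun s hs => Fc_deriv (by linarith) hs.1 hs.2

/-- time reversal -/
lemma reverse (h : Bridge P t0 t1 x0 x1 B) :
    Bridge P t0 t1 x1 x0 (fun t => B (t0 + t1 - t)) where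
  lt := h.lt
  meas := fun s => h.meas _
  cont := by
    filter_upwards [h.cont] with ω hω
    refine hω.comp (by fun_prop) ?_
    intro t ht
    exact ⟨by linarith [ht.2], by linarith [ht.1]⟩
  gauss := by
    intro k ts c hts
    have hl : t1 - t0 ≠ 0 := by have := h.lt; intro; linarith
    rw [h.gauss k (fun i => t0 + t1 - ts i) c
      (fun i => ⟨by linarith [(hts i).2], by linarith [(hts i).1]⟩)]
    refine congrArg₂ gaussianReal ?_ (congrArg Real.toNNReal ?_)
    · refine Finset.sum_congr rfl fun i _ => ?_
      field_simp
      ring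
    · refine Finset.sum_congr rfl fun i _ => Finset.sum_congr rfl fun j _ => ?_
      rw [min_sub_sub_left, max_sub_sub_left]
      ring

theorem core' (h : Bridge P t0 t1 x0 x1 B) (hx : x0 ≤ x1) {θ : Ω → ℝ} (hθm : Measurable θ)
    (huniq : ∀ᵐ ω ∂P, ∃! s, s ∈ Set.Icc t0 t1 ∧ IsMinOn (fun u => B u ω) (Set.Icc t0 t1) s)
    (hθ : ∀ᵐ ω ∂P, θ ω ∈ Set.Icc t0 t1 ∧ IsMinOn (fun u => B u ω) (Set.Icc t0 t1) (θ ω)) :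
    P.map θ = volume.withDensity (fun s => ENNReal.ofReal
      (if t0 ≤ s ∧ s ≤ t1 then dens t0 t1 (x1 - x0) (t0 + t1 - s) else 0)) := by
  have hmin : ∀ ω r, (t0 + t1 - r ∈ Set.Icc t0 t1 ∧
      IsMinOn (fun u => B (t0 + t1 - u) ω) (Set.Icc t0 t1) (t0 + t1 - r)) ↔
      (r ∈ Set.Icc t0 t1 ∧ IsMinOn (fun u => B u ω) (Set.Icc t0 t1) r) := by
    intro ω r
    refine and_congr ⟨fun h => ⟨by linarith [h.2], by linarith [h.1]⟩,
      fun h => ⟨by linarith [h.2], by linarith [h.1]⟩⟩ ⟨fun h u hu => ?_, fun h u hu => ?_⟩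
    · have := h (a := t0 + t1 - u) ⟨by linarith [hu.2], by linarith [hu.1]⟩
      simpa using this
    · have := h (a := t0 + t1 - u) ⟨by linarith [hu.2], by linarith [hu.1]⟩
      simpa using this
  have hm' : Measurable (fun ω => t0 + t1 - θ ω) := measurable_const.sub hθm
  have hc := h.reverse.core hx (θ := fun ω => t0 + t1 - θ ω) hm' ?_ ?_
  · have hmp : MeasurePreserving (fun s : ℝ => t0 + t1 - s) volume volume :=
      Measure.measurePreserving_sub_left volume (t0 + t1)
    have hθ' : P.map θ = (P.map (fun ω => t0 + t1 - θ ω)).map (fun s => t0 + t1 - s) := by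
      rw [Measure.map_map hmp.measurable hm']
      congr 1; ext ω; simp
    rw [hθ', hc]
    ext A hA
    rw [Measure.map_apply hmp.measurable hA, withDensity_apply _ (hmp.measurable hA),
      withDensity_apply _ hA]
    have he : MeasurableEmbedding (fun s : ℝ => t0 + t1 - s) :=
      (MeasurableEquiv.subLeft (t0 + t1)).measurableEmbedding
    rw [← hmp.setLIntegral_comp_preimage_emb he]
    have hAA : (fun s : ℝ => t0 + t1 - s) ⁻¹' ((fun s : ℝ => t0 + t1 - s) ⁻¹' A) = A := by
      ext; simp
    rw [hAA]
    refine lintegral_congr fun s => ?_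
    congr 1
    refine if_congr ?_ rfl rfl
    constructor <;> rintro ⟨a, b⟩ <;> constructor <;> linarith
  · filter_upwards [huniq] with ω ⟨r, hr, hu⟩
    refine ⟨t0 + t1 - r, (hmin ω r).2 hr, fun v hv => ?_⟩
    have := hu (t0 + t1 - v) ((hmin ω _).1 (by simpa using hv))
    linarith
  · filter_upwards [hθ] with ω hω using (hmin ω _).2 hω

end Bridge


open MeasureTheory ProbabilityTheory Real

/-- Density of the location of the minimum of a Brownian bridge `B`
from `(tj, xj)` to `(tj1, xj1)`: with `ℓ = tj1 − tj`, `d = |xj1 − xj|`,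
`h(s) = (tj1−s)/(s−tj)` if `xj1 ≤ xj` and `h(s) = (s−tj)/(tj1−s)` if `xj ≤ xj1`, the law
of `θ(B)` has density
`f(s) = (d/ℓ^{3/2})√(2/(π h(s))) exp(−(d²/(2ℓ))h(s))
        + ((ℓ−d²)/ℓ²) erfc(((d²/(2ℓ))h(s))^{1/2})`
on `[tj, tj1]` and `0` outside, where `erfc x = 1 − (2/√π)∫₀ˣ e^{−u²} du`. -/
theorem density_of_argmin_of_bridge
    {Ω : Type*} [MeasurableSpace Ω] (P : Measure Ω) [IsProbabilityMeasure P]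
    (tj tj1 xj xj1 : ℝ) (ht : tj < tj1)
    (B : ℝ → Ω → ℝ)
    (hmeas : ∀ s, Measurable (B s))
    -- almost surely continuous paths
    (hcont : ∀ᵐ ω ∂P, ContinuousOn (fun s => B s ω) (Set.Icc tj tj1))
    -- Gaussian finite-dimensional distributions with the bridge mean and covariance
    (hgauss : ∀ (k : ℕ) (ts : Fin k → ℝ) (c : Fin k → ℝ),
      (∀ i, ts i ∈ Set.Icc tj tj1) →
      P.map (fun ω => ∑ i, c i * B (ts i) ω) =
        gaussianReal
          (∑ i, c i * (xj + (ts i - tj) / (tj1 - tj) * (xj1 - xj)))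
          (Real.toNNReal (∑ i, ∑ i', c i * c i' *
            ((min (ts i) (ts i') - tj) * (tj1 - max (ts i) (ts i')) / (tj1 - tj)))))
    -- the minimum is attained at an a.s. unique point, selected measurably by θ
    (huniq : ∀ᵐ ω ∂P, ∃! s, s ∈ Set.Icc tj tj1 ∧
      IsMinOn (fun u => B u ω) (Set.Icc tj tj1) s)
    (θ : Ω → ℝ) (hθmeas : Measurable θ)
    (hθ : ∀ᵐ ω ∂P, θ ω ∈ Set.Icc tj tj1 ∧
      IsMinOn (fun u => B u ω) (Set.Icc tj tj1) (θ ω)) :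
    P.map θ = volume.withDensity (fun s => ENNReal.ofReal
      (if tj ≤ s ∧ s ≤ tj1 then
        (|xj1 - xj| / (tj1 - tj) ^ ((3 : ℝ) / 2)) *
          Real.sqrt (2 / (Real.pi *
            (if xj1 ≤ xj then (tj1 - s) / (s - tj) else (s - tj) / (tj1 - s)))) *
          Real.exp (-(|xj1 - xj| ^ 2 / (2 * (tj1 - tj))) *
            (if xj1 ≤ xj then (tj1 - s) / (s - tj) else (s - tj) / (tj1 - s))) +
        ((tj1 - tj) - |xj1 - xj| ^ 2) / (tj1 - tj) ^ 2 *
          (1 - (2 / Real.sqrt Real.pi) *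
            ∫ u in (0 : ℝ)..(Real.sqrt (|xj1 - xj| ^ 2 / (2 * (tj1 - tj)) *
              (if xj1 ≤ xj then (tj1 - s) / (s - tj) else (s - tj) / (tj1 - s)))),
              Real.exp (-u ^ 2))
      else 0)) := by
  have h : Bridge P tj tj1 xj xj1 B := ⟨ht, hmeas, hcont, hgauss⟩
  by_cases hx : xj1 ≤ xj
  · rw [h.core hx hθmeas huniq hθ]
    have ha : |xj1 - xj| = xj - xj1 := by rw [abs_of_nonpos (by linarith), neg_sub]
    simp only [hx, if_true, dens, Ef, ha]
  · rw [h.core' (not_le.1 hx).le hθmeas huniq hθ]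
    have ha : |xj1 - xj| = xj1 - xj := abs_of_nonneg (by linarith)
    have e : ∀ s, (tj1 - (tj + tj1 - s)) / ((tj + tj1 - s) - tj) = (s - tj) / (tj1 - s) := by
      intro s; congr 1 <;> ring
    simp only [hx, if_false, dens, Ef, ha, e]
end

section
/- Let t_j < t_{j+1}, x_j, x_{j+1} ∈ ℝ with x_j ≤ x_{j+1}, ℓ = t_{j+1} − t_j, d = x_{j+1} − x_j. Then for every s with t_j < s < t_{j+1}, ∫_{−∞}^{x_j} ((x_j − y)(x_{j+1} − y) √(2ℓ) / √(π (s − t_j)³ (t_{j+1} − s)³)) · exp(d²/(2ℓ) − (x_j − y)²/(2(s − t_j)) − (x_{j+1} − y)²/(2(t_{j+1} − s))) dy = (d/ℓ^{3/2}) √(2/(π h(s))) exp(−(d²/(2ℓ)) h(s)) + ((ℓ − d²)/ℓ²) erfc( ((d²/(2ℓ)) h(s))^{1/2} ), where h(s) = (s − t_j)/(t_{j+1} − s) and erfc(x) = 1 − (2/√π)∫_0^x e^{−t²} dt. -/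
open MeasureTheory Real

theorem aux_erf_tendsto :
    Filter.Tendsto (fun x : ℝ => ∫ u in (0:ℝ)..x, Real.exp (-u ^ 2)) Filter.atTop
      (nhds (Real.sqrt Real.pi / 2)) := by
  have h1 := integral_gaussian_Ioi 1
  have h2 : Integrable (fun u : ℝ => Real.exp (-u ^ 2)) := by
    simpa using integrable_exp_neg_mul_sq (b := 1) one_pos
  have h3 := intervalIntegral_tendsto_integral_Ioi (0:ℝ) h2.integrableOn Filter.tendsto_id
  simp at h1
  rw [h1] at h3
  exact h3

theorem aux_core (a b d p c m r : ℝ) (hd : 0 ≤ d) (hr : 0 < r)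
    (hc : c = r ^ 2) (hb : b = d - 2 * m) (ha : a = m * (d - m)) :
    ∫ z in Set.Ioi (-p), (p + z) * (p + z + d) * Real.exp (-c * (p + z + m) ^ 2) =
      1 / (2 * c) * (m + b) * Real.exp (-c * m ^ 2) + (1 / (2 * c) - a) / r *
        (Real.sqrt Real.pi / 2 - ∫ u in (0:ℝ)..(r * m), Real.exp (-u ^ 2)) := by
  have hc0 : 0 < c := by rw [hc]; positivity
  set G : ℝ → ℝ := fun x => ∫ u in (0:ℝ)..x, Real.exp (-u ^ 2) with hG
  have hGd : ∀ x, HasDerivAt G (Real.exp (-x ^ 2)) x := fun x =>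
    (Continuous.integral_hasStrictDerivAt (by fun_prop) 0 x).hasDerivAt
  have hder : ∀ z ∈ Set.Ici (-p), HasDerivAt
      (fun z => -(1 / (2 * c)) * ((p + z + m) + b) * Real.exp (-c * (p + z + m) ^ 2)
        + (1 / (2 * c) - a) / r * G (r * (p + z + m)))
      ((p + z) * (p + z + d) * Real.exp (-c * (p + z + m) ^ 2)) z := by
    intro z _
    have hw : HasDerivAt (fun z : ℝ => p + z + m) 1 z := by
      simpa using ((hasDerivAt_id z).const_add p).add_const m
    have h1 := ((hw.add_const b).const_mul (-(1 / (2 * c)))).mul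
      (((hw.pow 2).const_mul (-c)).exp)
    have h2 := ((hGd (r * (p + z + m))).comp z (hw.const_mul r)).const_mul ((1 / (2 * c) - a) / r)
    have h3 := h1.add h2
    refine h3.congr_deriv ?_
    have e : -(r * (p + z + m)) ^ 2 = -c * (p + z + m) ^ 2 := by rw [hc]; ring
    rw [e]
    simp only [Pi.pow_apply]
    generalize Real.exp (-c * (p + z + m) ^ 2) = E
    rw [hb, ha]
    field_simp
    push_cast
    ring
  have hw : Filter.Tendsto (fun z : ℝ => p + z + m) Filter.atTop Filter.atTop :=
    Filter.tendsto_atTop_add_const_right _ _ (Filter.tendsto_atTop_add_const_left _ _ Filter.tendsto_id)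
  have hE0 : Filter.Tendsto (fun w : ℝ => (w + b) * Real.exp (-c * w ^ 2)) Filter.atTop (nhds 0) := by
    have h1 := tendsto_rpow_abs_mul_exp_neg_mul_sq_cocompact hc0 1
    have h0 := tendsto_rpow_abs_mul_exp_neg_mul_sq_cocompact hc0 0
    have h1' := h1.mono_left (atTop_le_cocompact (α := ℝ))
    have h0' := h0.mono_left (atTop_le_cocompact (α := ℝ))
    have h := h1'.add (h0'.const_mul b)
    simp only [mul_zero, add_zero] at h
    refine h.congr' ?_
    filter_upwards [Filter.eventually_ge_atTop 0] with x hx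
    simp [abs_of_nonneg hx]
    ring
  have hlim : Filter.Tendsto
      (fun z => -(1 / (2 * c)) * ((p + z + m) + b) * Real.exp (-c * (p + z + m) ^ 2)
        + (1 / (2 * c) - a) / r * G (r * (p + z + m))) Filter.atTop
      (nhds (-(1 / (2 * c)) * 0 + (1 / (2 * c) - a) / r * (Real.sqrt Real.pi / 2))) := by
    refine Filter.Tendsto.add ?_ (Filter.Tendsto.const_mul _ ?_)
    · refine ((hE0.comp hw).const_mul (-(1 / (2 * c)))).congr fun z => ?_
      simp only [Function.comp]; ring
    · exact aux_erf_tendsto.comp (hw.const_mul_atTop hr)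
  rw [integral_Ioi_of_hasDerivAt_of_nonneg' hder ?_ hlim]
  · simp only [add_neg_cancel, zero_add]
    ring
  · intro z hz
    have : 0 < p + z := by have := Set.mem_Ioi.1 hz; linarith
    positivity

/-- Integrating the joint density of `(m(B), θ(B))` over the value `y`
of the minimum yields the marginal density of the location: for `xj ≤ xj1`,
`ℓ = tj1 − tj`, `d = xj1 − xj`, `h(s) = (s−tj)/(tj1−s)` and `tj < s < tj1`,
`∫_{−∞}^{xj} ((xj−y)(xj1−y)√(2ℓ)/√(π(s−tj)³(tj1−s)³))
    exp(d²/(2ℓ) − (xj−y)²/(2(s−tj)) − (xj1−y)²/(2(tj1−s))) dy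
  = (d/ℓ^{3/2})√(2/(π h(s))) exp(−(d²/(2ℓ))h(s))
    + ((ℓ−d²)/ℓ²) erfc(((d²/(2ℓ))h(s))^{1/2})`. -/
theorem integral_joint_density_over_min_value
    (tj tj1 xj xj1 : ℝ) (ht : tj < tj1) (hx : xj ≤ xj1) :
    ∀ s : ℝ, tj < s → s < tj1 →
      (∫ y in Set.Iio xj,
          (xj - y) * (xj1 - y) * Real.sqrt (2 * (tj1 - tj)) /
            Real.sqrt (Real.pi * (s - tj) ^ 3 * (tj1 - s) ^ 3) *
          Real.exp ((xj1 - xj) ^ 2 / (2 * (tj1 - tj)) -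
            (xj - y) ^ 2 / (2 * (s - tj)) - (xj1 - y) ^ 2 / (2 * (tj1 - s)))) =
        ((xj1 - xj) / (tj1 - tj) ^ ((3 : ℝ) / 2)) *
          Real.sqrt (2 / (Real.pi * ((s - tj) / (tj1 - s)))) *
          Real.exp (-((xj1 - xj) ^ 2 / (2 * (tj1 - tj))) * ((s - tj) / (tj1 - s))) +
        ((tj1 - tj) - (xj1 - xj) ^ 2) / (tj1 - tj) ^ 2 *
          (1 - (2 / Real.sqrt Real.pi) *
            ∫ u in (0 : ℝ)..(Real.sqrt ((xj1 - xj) ^ 2 / (2 * (tj1 - tj)) *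
              ((s - tj) / (tj1 - s)))), Real.exp (-u ^ 2)) := by
  intro s h1 h2
  obtain ⟨a, ha⟩ : ∃ a, a = s - tj := ⟨_, rfl⟩
  obtain ⟨b, hb⟩ : ∃ b, b = tj1 - s := ⟨_, rfl⟩
  obtain ⟨d, hd⟩ : ∃ d, d = xj1 - xj := ⟨_, rfl⟩
  obtain ⟨l, hl⟩ : ∃ l, l = tj1 - tj := ⟨_, rfl⟩
  have ha0 : 0 < a := by linarith
  have hb0 : 0 < b := by linarith
  have hd0 : 0 ≤ d := by linarith
  have hl0 : 0 < l := by linarith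
  have hlab : l = a + b := by linarith
  have hx1 : xj1 = xj + d := by linarith
  rw [← ha, ← hb, ← hd, ← hl, ← integral_Iic_eq_integral_Iio]
  have hneg := integral_comp_neg_Ioi (-xj) (fun y => (xj - y) * (xj1 - y) * Real.sqrt (2 * l) /
            Real.sqrt (Real.pi * a ^ 3 * b ^ 3) *
          Real.exp (d ^ 2 / (2 * l) -
            (xj - y) ^ 2 / (2 * a) - (xj1 - y) ^ 2 / (2 * b)))
  rw [neg_neg] at hneg
  rw [← hneg]
  obtain ⟨r, hr⟩ : ∃ r, r = Real.sqrt (l / (2 * a * b)) := ⟨_, rfl⟩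
  have hr0 : 0 < r := by rw [hr]; positivity
  have hr2 : l / (2 * a * b) = r ^ 2 := by rw [hr, Real.sq_sqrt (by positivity)]
  have hcore := aux_core (d ^ 2 * a * b / l ^ 2) (d * (b - a) / l) d xj (l / (2 * a * b))
    (d * a / l) r hd0 hr0 hr2 (by rw [hlab]; field_simp; ring) (by rw [hlab]; field_simp; ring)
  have hfun : ∀ z : ℝ, (xj - -z) * (xj1 - -z) * Real.sqrt (2 * l) /
            Real.sqrt (Real.pi * a ^ 3 * b ^ 3) *
          Real.exp (d ^ 2 / (2 * l) -
            (xj - -z) ^ 2 / (2 * a) - (xj1 - -z) ^ 2 / (2 * b)) =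
      Real.sqrt (2 * l) / Real.sqrt (Real.pi * a ^ 3 * b ^ 3) *
        ((xj + z) * (xj + z + d) * Real.exp (-(l / (2 * a * b)) * (xj + z + d * a / l) ^ 2)) := by
    intro z
    have e : d ^ 2 / (2 * l) - (xj - -z) ^ 2 / (2 * a) - (xj1 - -z) ^ 2 / (2 * b) =
        -(l / (2 * a * b)) * (xj + z + d * a / l) ^ 2 := by
      rw [hx1, hlab]; field_simp; ring
    rw [e, hx1]; ring
  simp only [hfun]
  rw [integral_const_mul, hcore]
  have hrm : Real.sqrt (d ^ 2 / (2 * l) * (a / b)) = r * (d * a / l) := by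
    rw [Real.sqrt_eq_iff_mul_self_eq (by positivity) (by positivity)]
    have : r * (d * a / l) * (r * (d * a / l)) = r ^ 2 * (d * a / l) ^ 2 := by ring
    rw [this, ← hr2]; field_simp
  have hee : -(l / (2 * a * b)) * (d * a / l) ^ 2 = -(d ^ 2 / (2 * l)) * (a / b) := by
    field_simp
  rw [hrm, hee]
  have hpi := Real.pi_pos
  have hp : 0 < Real.sqrt Real.pi := by positivity
  -- square root bookkeeping
  have hA : Real.sqrt (2 * l) / Real.sqrt (Real.pi * a ^ 3 * b ^ 3) =
      2 * r / (a * b * Real.sqrt Real.pi) := by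
    rw [← Real.sqrt_div (by positivity), Real.sqrt_eq_iff_mul_self_eq (by positivity) (by positivity)]
    have : 2 * r / (a * b * Real.sqrt Real.pi) * (2 * r / (a * b * Real.sqrt Real.pi)) =
      4 * r ^ 2 / (a ^ 2 * b ^ 2 * Real.sqrt Real.pi ^ 2) := by field_simp; ring
    rw [this, ← hr2, Real.sq_sqrt hpi.le]; field_simp; norm_num
  have hB : d / l ^ ((3 : ℝ) / 2) * Real.sqrt (2 / (Real.pi * (a / b))) =
      d * (2 * r * b / (l ^ 2 * Real.sqrt Real.pi)) := by
    have h32 : l ^ ((3 : ℝ) / 2) = l * Real.sqrt l := by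
      rw [show (3:ℝ) / 2 = 1 + 1 / 2 by norm_num, Real.rpow_add hl0, Real.rpow_one,
        Real.sqrt_eq_rpow]
    have hs : Real.sqrt (2 / (Real.pi * (a / b))) =
        Real.sqrt l * (2 * r * b / (l * Real.sqrt Real.pi)) := by
      rw [Real.sqrt_eq_iff_mul_self_eq (by positivity) (by positivity)]
      have : Real.sqrt l * (2 * r * b / (l * Real.sqrt Real.pi)) *
          (Real.sqrt l * (2 * r * b / (l * Real.sqrt Real.pi))) =
          Real.sqrt l ^ 2 * (4 * r ^ 2 * b ^ 2 / (l ^ 2 * Real.sqrt Real.pi ^ 2)) := by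
        field_simp; ring
      rw [this, ← hr2, Real.sq_sqrt hpi.le, Real.sq_sqrt hl0.le]; field_simp; norm_num
    have hsl : 0 < Real.sqrt l := by positivity
    rw [h32, hs]; field_simp
  rw [hA, hB]
  generalize Real.exp _ = E
  generalize (∫ u in (0:ℝ)..(r * (d * a / l)), Real.exp (-u ^ 2)) = I
  generalize Real.sqrt Real.pi = q at *
  have hsum : d * a / l + d * (b - a) / l = d * b / l := by ring
  rw [hsum]
  field_simp
end

section
/- Let t_j < t_{j+1}, x_j, x_{j+1} ∈ ℝ, ℓ = t_{j+1} − t_j, d = |x_{j+1} − x_j|. Then for every y < min(x_j, x_{j+1}), ∫_{t_j}^{t_{j+1}} ((x_j − y)(x_{j+1} − y) √(2ℓ) / √(π (s − t_j)³ (t_{j+1} − s)³)) · exp(d²/(2ℓ) − (x_j − y)²/(2(s − t_j)) − (x_{j+1} − y)²/(2(t_{j+1} − s))) ds = (2/ℓ)(x_j + x_{j+1} − 2y) exp(−2(x_j − y)(x_{j+1} − y)/ℓ). -/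
open MeasureTheory Real

open Set Filter Topology in
theorem ftc_nonneg_aux {f f' : ℝ → ℝ} {a b fa fb : ℝ} (hab : a < b)
    (hderiv : ∀ x ∈ Ioo a b, HasDerivAt f (f' x) x) (hpos : ∀ x ∈ Ioo a b, 0 ≤ f' x)
    (ha : Tendsto f (𝓝[>] a) (𝓝 fa)) (hb : Tendsto f (𝓝[<] b) (𝓝 fb)) :
    ∫ y in a..b, f' y = fb - fa := by
  refine intervalIntegral.integral_eq_sub_of_hasDerivAt_of_tendsto hab hderiv ?_ ha hb
  have hc : ContinuousOn f (Ioo a b) := fun x hx => (hderiv x hx).continuousAt.continuousWithinAt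
  refine intervalIntegral.intervalIntegrable_deriv_of_nonneg (g := extendFrom (Ioo a b) f) ?_ ?_ ?_
  · rw [uIcc_of_le hab.le]
    exact continuousOn_Icc_extendFrom_Ioo hc ha hb
  · rw [min_eq_left hab.le, max_eq_right hab.le]
    intro x hx
    refine (hderiv x hx).congr_of_eventuallyEq ?_
    filter_upwards [Ioo_mem_nhds hx.1 hx.2] with z hz
    exact extendFrom_eq (subset_closure hz) (hc z hz)
  · rw [min_eq_left hab.le, max_eq_right hab.le]
    exact hpos

/-- Gaussian primitive. -/
noncomputable def gPhi (c x : ℝ) : ℝ := ∫ t in (0:ℝ)..x, Real.exp (-c * t ^ 2)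

theorem gPhi_deriv (c x : ℝ) : HasDerivAt (gPhi c) (Real.exp (-c * x ^ 2)) x := by
  have h : Continuous (fun t : ℝ => Real.exp (-c * t ^ 2)) := by fun_prop
  exact intervalIntegral.integral_hasDerivAt_right (h.intervalIntegrable _ _)
    (h.stronglyMeasurableAtFilter _ _) h.continuousAt

open Filter Topology in
theorem gPhi_top {c : ℝ} (hc : 0 < c) : Tendsto (gPhi c) atTop (𝓝 (√(π / c) / 2)) := by
  rw [← integral_gaussian_Ioi]
  exact intervalIntegral_tendsto_integral_Ioi 0 (integrable_exp_neg_mul_sq hc).integrableOn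
    tendsto_id

theorem gPhi_neg (c x : ℝ) : gPhi c (-x) = - gPhi c x := by
  unfold gPhi
  have := intervalIntegral.integral_comp_neg (a := 0) (b := x)
    (fun t : ℝ => Real.exp (-c * t ^ 2))
  simp only [neg_sq, neg_zero] at this
  rw [this, intervalIntegral.integral_symm]

open Filter Topology in
theorem gPhi_bot {c : ℝ} (hc : 0 < c) : Tendsto (gPhi c) atBot (𝓝 (-(√(π / c) / 2))) := by
  have h := ((gPhi_top hc).comp tendsto_neg_atBot_atTop).neg
  refine h.congr fun x => ?_
  simp [gPhi_neg]

/-- Primitive in the variable `z = sqrt ((t1 - s) / (s - t0))`. -/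
noncomputable def gH (a b c z : ℝ) : ℝ :=
  (a + b) / (2 * a * b) * gPhi c (a * z - b * z⁻¹) +
  (b - a) / (2 * a * b) * Real.exp (4 * a * b * c) * gPhi c (a * z + b * z⁻¹)

theorem gH_deriv {a b : ℝ} (c : ℝ) {z : ℝ} (ha : 0 < a) (hb : 0 < b) (hz : 0 < z) :
    HasDerivAt (gH a b c) ((1 + (z ^ 2)⁻¹) * Real.exp (-c * (a * z - b * z⁻¹) ^ 2)) z := by
  have hi := (hasDerivAt_inv hz.ne').const_mul b
  have hl := (hasDerivAt_id z).const_mul a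
  have h1 := ((gPhi_deriv c (a * z - b * z⁻¹)).comp z (hl.sub hi)).const_mul
    ((a + b) / (2 * a * b))
  have h2 := ((gPhi_deriv c (a * z + b * z⁻¹)).comp z (hl.add hi)).const_mul
    ((b - a) / (2 * a * b) * Real.exp (4 * a * b * c))
  have e : Real.exp (-c * (a * z - b * z⁻¹) ^ 2) =
      Real.exp (4 * a * b * c) * Real.exp (-c * (a * z + b * z⁻¹) ^ 2) := by
    rw [← Real.exp_add]
    congr 1
    field_simp
    ring
  refine (h1.add h2).congr_deriv ?_
  rw [e]
  field_simp
  ring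

open Filter Topology in
theorem gH_top {a b c : ℝ} (ha : 0 < a) (hb : 0 < b) (hc : 0 < c) :
    Tendsto (gH a b c) atTop (𝓝 ((a + b) / (2 * a * b) * (√(π / c) / 2) +
      (b - a) / (2 * a * b) * Real.exp (4 * a * b * c) * (√(π / c) / 2))) := by
  have hl : Tendsto (fun z : ℝ => a * z) atTop atTop := tendsto_id.const_mul_atTop ha
  have hi : Tendsto (fun z : ℝ => b * z⁻¹) atTop (𝓝 (b * 0)) :=
    tendsto_inv_atTop_zero.const_mul b
  have h1 : Tendsto (fun z : ℝ => a * z - b * z⁻¹) atTop atTop := by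
    simpa [sub_eq_add_neg] using hl.atTop_add hi.neg
  have h2 : Tendsto (fun z : ℝ => a * z + b * z⁻¹) atTop atTop := hl.atTop_add hi
  exact (((gPhi_top hc).comp h1).const_mul _).add (((gPhi_top hc).comp h2).const_mul _)

open Filter Topology Set in
theorem gH_zero {a b c : ℝ} (hb : 0 < b) (hc : 0 < c) :
    Tendsto (gH a b c) (𝓝[>] 0) (𝓝 ((a + b) / (2 * a * b) * (-(√(π / c) / 2)) +
      (b - a) / (2 * a * b) * Real.exp (4 * a * b * c) * (√(π / c) / 2))) := by
  have hl : Tendsto (fun z : ℝ => a * z) (𝓝[>] 0) (𝓝 (a * 0)) :=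
    (tendsto_nhdsWithin_of_tendsto_nhds tendsto_id).const_mul a
  have hi : Tendsto (fun z : ℝ => b * z⁻¹) (𝓝[>] 0) atTop :=
    tendsto_inv_nhdsGT_zero.const_mul_atTop hb
  have h1 : Tendsto (fun z : ℝ => a * z - b * z⁻¹) (𝓝[>] 0) atBot := by
    have := hl.add_atBot (tendsto_neg_atTop_atBot.comp hi)
    simpa [sub_eq_add_neg] using this
  have h2 : Tendsto (fun z : ℝ => a * z + b * z⁻¹) (𝓝[>] 0) atTop := hl.add_atTop hi
  exact (((gPhi_bot hc).comp h1).const_mul _).add (((gPhi_top hc).comp h2).const_mul _)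

open Filter Topology Set in
theorem r_left {p q : ℝ} (h : p < q) :
    Tendsto (fun s : ℝ => √((q - s) / (s - p))) (𝓝[>] p) atTop := by
  refine Real.tendsto_sqrt_atTop.comp ?_
  have h1 : Tendsto (fun s : ℝ => q - s) (𝓝[>] p) (𝓝 (q - p)) :=
    ((continuous_const.sub continuous_id).tendsto p).mono_left nhdsWithin_le_nhds
  have h2 : Tendsto (fun s : ℝ => s - p) (𝓝[>] p) (𝓝[>] 0) := by
    refine tendsto_nhdsWithin_iff.2 ⟨?_, ?_⟩
    · have hc : Continuous (fun s : ℝ => s - p) := by fun_prop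
      have := (hc.tendsto p).mono_left (nhdsWithin_le_nhds (s := Ioi p))
      simpa using this
    · filter_upwards [self_mem_nhdsWithin] with s hs
      exact sub_pos.2 (Set.mem_Ioi.1 hs)
  exact h1.pos_mul_atTop (sub_pos.2 h) (tendsto_inv_nhdsGT_zero.comp h2)

open Filter Topology Set in
theorem r_right {p q : ℝ} (h : p < q) :
    Tendsto (fun s : ℝ => √((q - s) / (s - p))) (𝓝[<] q) (𝓝[>] 0) := by
  refine tendsto_nhdsWithin_iff.2 ⟨?_, ?_⟩
  · have : ContinuousAt (fun s : ℝ => √((q - s) / (s - p))) q := by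
      have : q - p ≠ 0 := (sub_pos.2 h).ne'
      fun_prop (disch := assumption)
    have h2 := this.tendsto.mono_left (nhdsWithin_le_nhds (s := Iio q))
    simpa using h2
  · filter_upwards [Ioo_mem_nhdsLT h] with s hs
    exact Real.sqrt_pos.2 (div_pos (sub_pos.2 hs.2) (sub_pos.2 hs.1))


/-- Integrating the joint density of `(m(B), θ(B))` over the location
`s` yields the marginal density of the minimum: with `ℓ = tj1 − tj`, `d = |xj1 − xj|`,
for every `y < min(xj, xj1)`,
`∫_{tj}^{tj1} ((xj−y)(xj1−y)√(2ℓ)/√(π(s−tj)³(tj1−s)³))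
    exp(d²/(2ℓ) − (xj−y)²/(2(s−tj)) − (xj1−y)²/(2(tj1−s))) ds
  = (2/ℓ)(xj + xj1 − 2y) exp(−2(xj−y)(xj1−y)/ℓ)`. -/
theorem integral_joint_density_over_location
    (tj tj1 xj xj1 : ℝ) (ht : tj < tj1) :
    ∀ y : ℝ, y < min xj xj1 →
      (∫ s in tj..tj1,
          (xj - y) * (xj1 - y) * Real.sqrt (2 * (tj1 - tj)) /
            Real.sqrt (Real.pi * (s - tj) ^ 3 * (tj1 - s) ^ 3) *
          Real.exp (|xj1 - xj| ^ 2 / (2 * (tj1 - tj)) -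
            (xj - y) ^ 2 / (2 * (s - tj)) - (xj1 - y) ^ 2 / (2 * (tj1 - s)))) =
        2 / (tj1 - tj) * (xj + xj1 - 2 * y) *
          Real.exp (-2 * (xj - y) * (xj1 - y) / (tj1 - tj)) := by
  intro y hy
  obtain ⟨hy1, hy2⟩ := lt_min_iff.1 hy
  obtain ⟨a, ha⟩ : ∃ a, a = xj - y := ⟨_, rfl⟩
  obtain ⟨b, hb⟩ : ∃ b, b = xj1 - y := ⟨_, rfl⟩
  obtain ⟨l, hl⟩ : ∃ l, l = tj1 - tj := ⟨_, rfl⟩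
  have ha0 : 0 < a := by linarith
  have hb0 : 0 < b := by linarith
  have hl0 : 0 < l := by linarith
  have hd : |xj1 - xj| ^ 2 = (b - a) ^ 2 := by rw [sq_abs, ha, hb]; ring
  have hs : xj + xj1 - 2 * y = a + b := by rw [ha, hb]; ring
  rw [hd, hs, ← ha, ← hb, ← hl]
  have hc0 : 0 < 1 / (2 * l) := by positivity
  have hpi : 0 < √π := Real.sqrt_pos.2 Real.pi_pos
  set E := Real.exp (-2 * a * b / l) with hE
  set K := 2 * a * b * √(2 * l) / (√π * l ^ 2) * E with hK
  have main := ftc_nonneg_aux (f := fun s => -K * gH a b (1 / (2 * l)) (√((tj1 - s) / (s - tj))))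
    (f' := fun s => a * b * √(2 * l) / √(π * (s - tj) ^ 3 * (tj1 - s) ^ 3) *
      Real.exp ((b - a) ^ 2 / (2 * l) - a ^ 2 / (2 * (s - tj)) - b ^ 2 / (2 * (tj1 - s)))) ht
    ?_ ?_ (((gH_top ha0 hb0 hc0).comp (r_left ht)).const_mul (-K))
    (((gH_zero (a := a) hb0 hc0).comp (r_right ht)).const_mul (-K))
  · rw [main, hK]
    have e : √(π / (1 / (2 * l))) = √π * √(2 * l) := by
      rw [← Real.sqrt_mul Real.pi_pos.le]; congr 1; field_simp
    rw [e]
    have e2 : √(2 * l) ^ 2 = 2 * l := Real.sq_sqrt (by positivity)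
    have key : 2 * a * b * √(2 * l) / (√π * l ^ 2) * E *
        ((a + b) / (2 * a * b) * (√π * √(2 * l))) = 2 / l * (a + b) * E := by
      have : 2 * a * b * √(2 * l) / (√π * l ^ 2) * E *
        ((a + b) / (2 * a * b) * (√π * √(2 * l))) = √(2 * l) ^ 2 * (a + b) * E / l ^ 2 := by
        field_simp
      rw [this, e2]
      field_simp
    rw [← key]
    ring
  · intro s hs
    have hu : 0 < s - tj := sub_pos.2 hs.1
    have hv : 0 < tj1 - s := sub_pos.2 hs.2
    have hr := div_pos hv hu
    have hq : HasDerivAt (fun s : ℝ => (tj1 - s) / (s - tj)) (-l / (s - tj) ^ 2) s := by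
      refine (((hasDerivAt_id s).const_sub tj1).div ((hasDerivAt_id s).sub_const tj)
        hu.ne').congr_deriv ?_
      simp only [id]
      rw [hl]
      congr 1
      ring
    have hh := (((gH_deriv (1 / (2 * l)) ha0 hb0 (Real.sqrt_pos.2 hr)).comp s
      (hq.sqrt hr.ne')).const_mul (-K))
    refine hh.congr_deriv ?_
    have hr0 := Real.sqrt_pos.2 hr
    have hr2 := Real.sq_sqrt hr.le
    set r := √((tj1 - s) / (s - tj)) with hrdef
    obtain ⟨u, hu'⟩ : ∃ u, u = s - tj := ⟨_, rfl⟩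
    have hvr : tj1 - s = u * r ^ 2 := by rw [hr2, hu']; field_simp
    have hlr : l = u * (1 + r ^ 2) := by rw [mul_add, ← hvr, hu', hl]; ring
    rw [hvr, ← hu']
    rw [← hu'] at hu
    have e3 : √(π * u ^ 3 * (u * r ^ 2) ^ 3) = √π * (u * r) ^ 3 := by
      rw [show π * u ^ 3 * (u * r ^ 2) ^ 3 = π * (((u * r) ^ 3) ^ 2) by ring,
        Real.sqrt_mul Real.pi_pos.le, Real.sqrt_sq (by positivity)]
      all_goals ring
    have hexp : Real.exp ((b - a) ^ 2 / (2 * l) - a ^ 2 / (2 * u) - b ^ 2 / (2 * (u * r ^ 2))) =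
        E * Real.exp (-(1 / (2 * l)) * (a * r - b * r⁻¹) ^ 2) := by
      rw [hE, ← Real.exp_add]
      congr 1
      rw [hlr]
      field_simp
      ring
    rw [e3, hexp, hK]
    generalize Real.exp (-(1 / (2 * l)) * (a * r - b * r⁻¹) ^ 2) = X
    generalize √(2 * l) = L
    rw [hlr]
    field_simp
    try ring
  · intro s hs
    positivity
end

section
/- Let t_j < t_{j+1}, ℓ = t_{j+1} − t_j > 0, and d ≥ 0. Then ∫_{t_j}^{t_{j+1}} [ (d/ℓ^{3/2}) √(2/(π h(s))) exp(−(d²/(2ℓ)) h(s)) + ((ℓ − d²)/ℓ²) erfc( ((d²/(2ℓ)) h(s))^{1/2} ) ] ds = 1, where h(s) = (s − t_j)/(t_{j+1} − s) and erfc(x) = 1 − (2/√π)∫_0^x e^{−t²} dt. -/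
open MeasureTheory Real

lemma aux_gauss_integrable : Integrable (fun u : ℝ => Real.exp (-u ^ 2)) := by
  simpa using integrable_exp_neg_mul_sq (b := 1) one_pos

lemma aux_gauss_deriv (y : ℝ) :
    HasDerivAt (fun y : ℝ => ∫ u in (0 : ℝ)..y, Real.exp (-u ^ 2)) (Real.exp (-y ^ 2)) y := by
  have hc : Continuous (fun u : ℝ => Real.exp (-u ^ 2)) := by fun_prop
  exact (hc.integral_hasStrictDerivAt 0 y).hasDerivAt

lemma aux_gauss_cont : Continuous (fun y : ℝ => ∫ u in (0 : ℝ)..y, Real.exp (-u ^ 2)) :=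
  continuous_iff_continuousAt.2 fun y => (aux_gauss_deriv y).continuousAt

lemma aux_gauss_tendsto :
    Filter.Tendsto (fun y : ℝ => ∫ u in (0 : ℝ)..y, Real.exp (-u ^ 2)) Filter.atTop
      (nhds (Real.sqrt Real.pi / 2)) := by
  have h := intervalIntegral_tendsto_integral_Ioi (0 : ℝ)
    aux_gauss_integrable.integrableOn Filter.tendsto_id
  have h2 : ∫ u in Set.Ioi (0 : ℝ), Real.exp (-u ^ 2) = Real.sqrt Real.pi / 2 := by
    simpa using integral_gaussian_Ioi 1
  rw [h2] at h
  exact h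

lemma aux_gauss_bound (y : ℝ) (hy : 0 ≤ y) :
    |∫ u in (0 : ℝ)..y, Real.exp (-u ^ 2)| ≤ Real.sqrt Real.pi := by
  have h2 : ∫ u : ℝ, Real.exp (-u ^ 2) = Real.sqrt Real.pi := by
    simpa using integral_gaussian 1
  rw [intervalIntegral.integral_of_le hy, ← h2,
    abs_of_nonneg (integral_nonneg fun u => (Real.exp_pos _).le)]
  exact setIntegral_le_integral aux_gauss_integrable
    (Filter.Eventually.of_forall fun u => (Real.exp_pos _).le)

lemma aux_xexp_tendsto :
    Filter.Tendsto (fun y : ℝ => y * Real.exp (-y ^ 2)) Filter.atTop (nhds 0) := by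
  have h := Real.tendsto_pow_mul_exp_neg_atTop_nhds_zero 1
  refine squeeze_zero' ?_ ?_ h
  · filter_upwards [Filter.eventually_ge_atTop 0] with y hy
    positivity
  · filter_upwards [Filter.eventually_ge_atTop 1] with y hy
    rw [pow_one]
    gcongr
    nlinarith

lemma aux_coef (d l h : ℝ) (hl : 0 < l) (hd : 0 < d) (hh : 0 < h) :
    d / l ^ ((3 : ℝ) / 2) * Real.sqrt (2 / (Real.pi * h)) =
      2 / Real.sqrt Real.pi * (d ^ 2 / (2 * l) / (Real.sqrt (d ^ 2 / (2 * l) * h) * l)) := by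
  have hpi := Real.pi_pos
  have e1 : l ^ ((3 : ℝ) / 2) = l * Real.sqrt l := by
    rw [show (3 : ℝ) / 2 = 1 + 1 / 2 by norm_num, Real.rpow_add hl, Real.rpow_one,
      Real.sqrt_eq_rpow]
  rw [e1]
  rw [← sq_eq_sq₀ (by positivity) (by positivity)]
  simp only [mul_pow, div_pow]
  rw [Real.sq_sqrt (by positivity), Real.sq_sqrt (by positivity), Real.sq_sqrt (by positivity),
    Real.sq_sqrt (by positivity)]
  field_simp
  try norm_num

lemma aux_integrable (tj tj1 d : ℝ) (ht : tj < tj1) :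
    IntervalIntegrable (fun s => ((d / (tj1 - tj) ^ ((3 : ℝ) / 2)) *
          Real.sqrt (2 / (Real.pi * ((s - tj) / (tj1 - s)))) *
          Real.exp (-(d ^ 2 / (2 * (tj1 - tj))) * ((s - tj) / (tj1 - s))) +
        ((tj1 - tj) - d ^ 2) / (tj1 - tj) ^ 2 *
          (1 - (2 / Real.sqrt Real.pi) *
            ∫ u in (0 : ℝ)..(Real.sqrt (d ^ 2 / (2 * (tj1 - tj)) * ((s - tj) / (tj1 - s)))),
              Real.exp (-u ^ 2)))) volume tj tj1 := by
  have hl : 0 < tj1 - tj := sub_pos.2 ht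
  have hpi := Real.pi_pos
  have hE := aux_gauss_cont.measurable
  refine IntervalIntegrable.add ?_ ?_
  · have hb : IntervalIntegrable (fun s => |d / (tj1 - tj) ^ ((3 : ℝ) / 2)| *
        Real.sqrt (2 / Real.pi * (tj1 - tj)) * (s - tj) ^ (-(1 / 2) : ℝ)) volume tj tj1 := by
      refine IntervalIntegrable.const_mul ?_ _
      have := (intervalIntegral.intervalIntegrable_rpow' (a := 0) (b := tj1 - tj)
        (r := (-(1 / 2) : ℝ)) (by norm_num)).comp_sub_right tj
      simpa using this
    refine hb.mono_fun' (Measurable.aestronglyMeasurable (by fun_prop)) ?_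
    rw [Set.uIoc_of_le ht.le]
    filter_upwards [ae_restrict_mem measurableSet_Ioc] with s hs
    have hv : 0 < s - tj := sub_pos.2 hs.1
    have hu : 0 ≤ tj1 - s := sub_nonneg.2 hs.2
    rw [Real.norm_eq_abs, abs_mul, abs_mul, abs_of_nonneg (Real.sqrt_nonneg _),
      abs_of_pos (Real.exp_pos _), mul_assoc, mul_assoc]
    refine mul_le_mul_of_nonneg_left ?_ (abs_nonneg _)
    have h1 : Real.exp (-(d ^ 2 / (2 * (tj1 - tj))) * ((s - tj) / (tj1 - s))) ≤ 1 := by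
      rw [Real.exp_le_one_iff, neg_mul, neg_nonpos]
      positivity
    have h2 : Real.sqrt (2 / (Real.pi * ((s - tj) / (tj1 - s)))) ≤
        Real.sqrt (2 / Real.pi * (tj1 - tj)) * (s - tj) ^ (-(1 / 2) : ℝ) := by
      rw [Real.rpow_neg hv.le, ← Real.sqrt_eq_rpow, ← Real.sqrt_inv, ← Real.sqrt_mul (by positivity)]
      apply Real.sqrt_le_sqrt
      have : 2 / (Real.pi * ((s - tj) / (tj1 - s))) = 2 / Real.pi * (tj1 - s) * (s - tj)⁻¹ := by
        rw [← mul_div_assoc, div_div_eq_mul_div]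
        field_simp
      rw [this]
      gcongr
      linarith [hs.1]
    exact (mul_le_of_le_one_right (Real.sqrt_nonneg _) h1).trans h2
  · refine IntervalIntegrable.const_mul ?_ _
    have hb : IntervalIntegrable (fun _ : ℝ => 1 + 2 / Real.sqrt Real.pi * Real.sqrt Real.pi)
      volume tj tj1 := intervalIntegrable_const
    refine hb.mono_fun' (Measurable.aestronglyMeasurable ?_) ?_
    · refine Measurable.const_sub (Measurable.const_mul ?_ _) _
      exact hE.comp (by fun_prop)
    · refine Filter.Eventually.of_forall fun s => ?_
      refine (norm_sub_le _ _).trans ?_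
      rw [norm_one, norm_mul, Real.norm_eq_abs, Real.norm_eq_abs,
        abs_of_nonneg (by positivity : 0 ≤ 2 / Real.sqrt Real.pi)]
      have h1 := mul_le_mul_of_nonneg_left (aux_gauss_bound _ (Real.sqrt_nonneg
        (d ^ 2 / (2 * (tj1 - tj)) * ((s - tj) / (tj1 - s)))))
        (by positivity : 0 ≤ 2 / Real.sqrt Real.pi)
      linarith

lemma aux_deriv (tj tj1 d c s : ℝ) (hd : 0 < d) (hs1 : tj < s) (hs2 : s < tj1)
    (hc : c = d ^ 2 / (2 * (tj1 - tj))) :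
    HasDerivAt (fun s => (-(1 - 2 * c) * ((tj1 - s) / (tj1 - tj)) - 2 * c) *
        (1 - (2 / Real.sqrt Real.pi) *
          ∫ u in (0 : ℝ)..(Real.sqrt (c * ((s - tj) / (tj1 - s)))), Real.exp (-u ^ 2)) +
        2 / Real.sqrt Real.pi * (((tj1 - s) / (tj1 - tj)) *
          (Real.sqrt (c * ((s - tj) / (tj1 - s))) *
            Real.exp (-(Real.sqrt (c * ((s - tj) / (tj1 - s)))) ^ 2))))
      ((d / (tj1 - tj) ^ ((3 : ℝ) / 2)) *
          Real.sqrt (2 / (Real.pi * ((s - tj) / (tj1 - s)))) *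
          Real.exp (-c * ((s - tj) / (tj1 - s))) +
        ((tj1 - tj) - d ^ 2) / (tj1 - tj) ^ 2 *
          (1 - (2 / Real.sqrt Real.pi) *
            ∫ u in (0 : ℝ)..(Real.sqrt (c * ((s - tj) / (tj1 - s)))),
              Real.exp (-u ^ 2))) s := by
  have hv : 0 < s - tj := sub_pos.2 hs1
  have hu : 0 < tj1 - s := sub_pos.2 hs2
  have hl : 0 < tj1 - tj := by linarith
  have hcp : 0 < c := by rw [hc]; positivity
  have hh : 0 < (s - tj) / (tj1 - s) := by positivity
  have hcoef := aux_coef d (tj1 - tj) _ hl hd hh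
  rw [← hc] at hcoef
  have hd2 : d ^ 2 = 2 * c * (tj1 - tj) := by rw [hc]; field_simp
  have hB : HasDerivAt (fun s => (tj1 - s) / (tj1 - tj)) (-1 / (tj1 - tj)) s :=
    ((hasDerivAt_id s).const_sub tj1).div_const _
  have hH := (((hasDerivAt_id s).sub_const tj).div ((hasDerivAt_id s).const_sub tj1)
    hu.ne').const_mul c
  have hY := hH.sqrt (by simpa using (mul_pos hcp hh).ne')
  simp only [id, Pi.div_apply] at hY
  have hyp : 0 < Real.sqrt (c * ((s - tj) / (tj1 - s))) := Real.sqrt_pos.2 (by positivity)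
  have hysq : Real.sqrt (c * ((s - tj) / (tj1 - s))) ^ 2 = c * ((s - tj) / (tj1 - s)) :=
    Real.sq_sqrt (by positivity)
  have hE := (((aux_gauss_deriv _).comp s hY).const_mul (2 / Real.sqrt Real.pi)).const_sub 1
  have hX := hY.mul ((hY.pow 2).neg.exp)
  have hF := (((hB.const_mul (-(1 - 2 * c))).sub_const (2 * c)).mul hE).add
    ((hB.mul hX).const_mul (2 / Real.sqrt Real.pi))
  refine hF.congr_deriv ?_
  simp only [Function.comp, Pi.mul_apply, Pi.pow_apply, Pi.neg_apply]
  rw [hcoef, hd2]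
  have he : Real.exp (-c * ((s - tj) / (tj1 - s))) =
      Real.exp (-(Real.sqrt (c * ((s - tj) / (tj1 - s)))) ^ 2) := by rw [hysq, neg_mul]
  rw [he]
  generalize (∫ u in (0 : ℝ)..(Real.sqrt (c * ((s - tj) / (tj1 - s)))), Real.exp (-u ^ 2)) = I
  generalize Real.exp (-(Real.sqrt (c * ((s - tj) / (tj1 - s)))) ^ 2) = e
  generalize hk : 2 / Real.sqrt Real.pi = k
  generalize Real.sqrt (c * ((s - tj) / (tj1 - s))) = y at *
  generalize hug : tj1 - s = u at *
  generalize hvg : s - tj = v at *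
  have hlu : tj1 - tj = u + v := by linarith
  rw [hlu] at *
  have hyu : y ^ 2 * u = c * v := by rw [hysq]; field_simp
  have hc2 : c = y ^ 2 * u / v := by field_simp; linarith
  subst hc2
  field_simp
  ring

theorem argmin_density_integrates_to_one
    (tj tj1 d : ℝ) (ht : tj < tj1) (hd : 0 ≤ d) :
    ∫ s in tj..tj1,
        ((d / (tj1 - tj) ^ ((3 : ℝ) / 2)) *
          Real.sqrt (2 / (Real.pi * ((s - tj) / (tj1 - s)))) *
          Real.exp (-(d ^ 2 / (2 * (tj1 - tj))) * ((s - tj) / (tj1 - s))) +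
        ((tj1 - tj) - d ^ 2) / (tj1 - tj) ^ 2 *
          (1 - (2 / Real.sqrt Real.pi) *
            ∫ u in (0 : ℝ)..(Real.sqrt (d ^ 2 / (2 * (tj1 - tj)) * ((s - tj) / (tj1 - s)))),
              Real.exp (-u ^ 2))) = 1 := by
  have hl : 0 < tj1 - tj := sub_pos.2 ht
  have hpi := Real.sqrt_pos.2 Real.pi_pos
  rcases hd.eq_or_lt with rfl | hd
  · simp
    field_simp
  have hint := aux_integrable tj tj1 d ht
  obtain ⟨c, hc⟩ : ∃ c, c = d ^ 2 / (2 * (tj1 - tj)) := ⟨_, rfl⟩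
  have hcp : 0 < c := by rw [hc]; positivity
  rw [← hc] at hint ⊢
  have key := intervalIntegral.integral_eq_sub_of_hasDerivAt_of_tendsto ht (fa := -1) (fb := 0)
    (fun s hs => aux_deriv tj tj1 d c s hd hs.1 hs.2 hc) hint ?_ ?_
  · rw [key]; norm_num
  · have hY : ContinuousAt (fun s => Real.sqrt (c * ((s - tj) / (tj1 - s)))) tj := by
      refine (ContinuousAt.mul continuousAt_const (ContinuousAt.div (by fun_prop) (by fun_prop)
        hl.ne')).sqrt
    have hE := ContinuousAt.comp (g := fun y : ℝ => ∫ u in (0 : ℝ)..y, Real.exp (-u ^ 2))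
      (x := tj) aux_gauss_cont.continuousAt hY
    have hF : ContinuousAt (fun s => (-(1 - 2 * c) * ((tj1 - s) / (tj1 - tj)) - 2 * c) *
        (1 - (2 / Real.sqrt Real.pi) *
          ∫ u in (0 : ℝ)..(Real.sqrt (c * ((s - tj) / (tj1 - s)))), Real.exp (-u ^ 2)) +
        2 / Real.sqrt Real.pi * (((tj1 - s) / (tj1 - tj)) *
          (Real.sqrt (c * ((s - tj) / (tj1 - s))) *
            Real.exp (-(Real.sqrt (c * ((s - tj) / (tj1 - s)))) ^ 2)))) tj := by
      refine ContinuousAt.add (ContinuousAt.mul (by fun_prop)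
        (continuousAt_const.sub (continuousAt_const.mul hE))) ?_
      refine continuousAt_const.mul (ContinuousAt.mul (by fun_prop) (hY.mul ?_))
      exact (hY.pow 2).neg.rexp
    have hT := hF.tendsto.mono_left (nhdsWithin_le_nhds (s := Set.Ioi tj))
    convert hT using 2
    simp [hl.ne']
  · have hu0 : Filter.Tendsto (fun s => tj1 - s) (nhdsWithin tj1 (Set.Iio tj1))
        (nhdsWithin 0 (Set.Ioi 0)) := by
      refine tendsto_nhdsWithin_iff.2 ⟨?_, ?_⟩
      · have : ContinuousAt (fun s => tj1 - s) tj1 := by fun_prop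
        simpa [ContinuousAt] using this.tendsto.mono_left (nhdsWithin_le_nhds (s := Set.Iio tj1))
      · filter_upwards [self_mem_nhdsWithin] with s hs
        exact sub_pos.2 (Set.mem_Iio.1 hs)
    have hv0 : Filter.Tendsto (fun s => s - tj) (nhdsWithin tj1 (Set.Iio tj1))
        (nhds (tj1 - tj)) := by
      have : ContinuousAt (fun s => s - tj) tj1 := by fun_prop
      exact this.tendsto.mono_left nhdsWithin_le_nhds
    have hh : Filter.Tendsto (fun s => (s - tj) / (tj1 - s)) (nhdsWithin tj1 (Set.Iio tj1))
        Filter.atTop := by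
      simp only [div_eq_mul_inv]
      exact hv0.pos_mul_atTop hl (tendsto_inv_nhdsGT_zero.comp hu0)
    have hY : Filter.Tendsto (fun s => Real.sqrt (c * ((s - tj) / (tj1 - s))))
        (nhdsWithin tj1 (Set.Iio tj1)) Filter.atTop :=
      Real.tendsto_sqrt_atTop.comp (hh.const_mul_atTop hcp)
    have hB : Filter.Tendsto (fun s => (tj1 - s) / (tj1 - tj)) (nhdsWithin tj1 (Set.Iio tj1))
        (nhds (0 / (tj1 - tj))) := (tendsto_nhdsWithin_iff.1 hu0).1.div_const _
    have hE := aux_gauss_tendsto.comp hY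
    have hX := aux_xexp_tendsto.comp hY
    have hF := (((hB.const_mul (-(1 - 2 * c))).sub_const (2 * c)).mul
      ((hE.const_mul (2 / Real.sqrt Real.pi)).const_sub 1)).add
      ((hB.mul hX).const_mul (2 / Real.sqrt Real.pi))
    have h0 : (-(1 - 2 * c) * (0 / (tj1 - tj)) - 2 * c) *
        (1 - 2 / Real.sqrt Real.pi * (Real.sqrt Real.pi / 2)) +
        2 / Real.sqrt Real.pi * (0 / (tj1 - tj) * 0) = 0 := by
      have : 2 / Real.sqrt Real.pi * (Real.sqrt Real.pi / 2) = 1 := by field_simp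
      rw [this]; ring
    rw [h0] at hF
    exact hF
end
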